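/- arXiv:1902.07030 — 5 statements merged into one kernel-verified Lean document; each statement's English description precedes it below -/
import Mathlib

section
/- Let μ and μ̃ be Borel probability measures on ℝ^d with Lebesgue densities f and f̃ such that f̃(x) > 0 for Lebesgue-a.e. x with f(x) > 0, and let w = f/f̃ (set to 0 where f̃ = 0). Define, for X̃, X̃', X̃'' i.i.d. with law μ̃ and Ỹ = F(X̃), Ỹ' = F(X̃'), Ỹ'' = F(X̃''): H̃¹ = E[l_k(X̃_k, X̃'_k) l(Ỹ, Ỹ') w(X̃) w(X̃')], H̃² = E[l_k(X̃_k, X̃'_k) w(X̃) w(X̃')], H̃³ = E[l(Ỹ, Ỹ') w(X̃) w(X̃')], and H̃⁴ = E[l_k(X̃_k, X̃'_k) l(Ỹ, Ỹ'') w(X̃) w(X̃') w(X̃'')]. Then HSIC(X_k, Y) = H̃¹ + H̃²·H̃³ − 2·H̃⁴; that is, the HSIC measure between X_k and Y under the input law μ can be expressed entirely by expectations under the alternative law μ̃ with importance weights w. -/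
open MeasureTheory

/-- The HSIC measure between X_k and Y = F(X) under the input law μ can be expressed
entirely by importance-weighted expectations under the alternative law μ̃:
HSIC(X_k, Y) = H̃¹ + H̃²·H̃³ − 2·H̃⁴. -/
theorem hsic_eq_weighted_expectations_under_alternative_law
    (d : ℕ) (k : Fin d)
    (F : (Fin d → ℝ) → ℝ) (hF : Measurable F)
    (lk l : ℝ → ℝ → ℝ)
    (hlkm : Measurable (Function.uncurry lk)) (hlm : Measurable (Function.uncurry l))
    (Ck Cl : ℝ) (hlkB : ∀ a b, |lk a b| ≤ Ck) (hlB : ∀ a b, |l a b| ≤ Cl)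
    (hlks : ∀ a b, lk a b = lk b a) (hls : ∀ a b, l a b = l b a)
    (f ftil : (Fin d → ℝ) → ℝ)
    (hfm : Measurable f) (hftm : Measurable ftil)
    (hf0 : ∀ x, 0 ≤ f x) (hft0 : ∀ x, 0 ≤ ftil x)
    (μ μtil : Measure (Fin d → ℝ))
    [IsProbabilityMeasure μ] [IsProbabilityMeasure μtil]
    (hμ : μ = (volume : Measure (Fin d → ℝ)).withDensity fun x => ENNReal.ofReal (f x))
    (hμt : μtil = (volume : Measure (Fin d → ℝ)).withDensity fun x => ENNReal.ofReal (ftil x))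
    (hsupp : ∀ᵐ x ∂(volume : Measure (Fin d → ℝ)), 0 < f x → 0 < ftil x)
    (w : (Fin d → ℝ) → ℝ) (hw : ∀ x, w x = f x / ftil x)
    -- HSIC(X_k, Y) under the original input law μ : H¹ + H²·H³ − 2·H⁴
    (HSIC : ℝ)
    (hHSIC : HSIC =
      (∫ x, (∫ x', lk (x k) (x' k) * l (F x) (F x') ∂μ) ∂μ)
      + (∫ x, (∫ x', lk (x k) (x' k) ∂μ) ∂μ) * (∫ x, (∫ x', l (F x) (F x') ∂μ) ∂μ)
      - 2 * (∫ x, (∫ y, (∫ z, lk (x k) (y k) * l (F x) (F z) ∂μ) ∂μ) ∂μ))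
    -- weighted expectations under the alternative law μ̃
    (H₁ H₂ H₃ H₄ : ℝ)
    (hH₁ : H₁ = ∫ x, (∫ x', lk (x k) (x' k) * l (F x) (F x') * w x * w x' ∂μtil) ∂μtil)
    (hH₂ : H₂ = ∫ x, (∫ x', lk (x k) (x' k) * w x * w x' ∂μtil) ∂μtil)
    (hH₃ : H₃ = ∫ x, (∫ x', l (F x) (F x') * w x * w x' ∂μtil) ∂μtil)
    (hH₄ : H₄ = ∫ x, (∫ y, (∫ z, lk (x k) (y k) * l (F x) (F z) * w x * w y * w z ∂μtil) ∂μtil) ∂μtil) :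
    HSIC = H₁ + H₂ * H₃ - 2 * H₄ := by
  have key : ∀ g : (Fin d → ℝ) → ℝ, ∫ x, g x * w x ∂μtil = ∫ x, g x ∂μ := by
    intro g
    rw [hμ, hμt,
      integral_withDensity_eq_integral_toReal_smul hfm.ennreal_ofReal
        (Filter.Eventually.of_forall fun x => ENNReal.ofReal_lt_top),
      integral_withDensity_eq_integral_toReal_smul hftm.ennreal_ofReal
        (Filter.Eventually.of_forall fun x => ENNReal.ofReal_lt_top)]
    apply integral_congr_ae
    filter_upwards [hsupp] with x hx
    simp only [ENNReal.toReal_ofReal (hf0 x), ENNReal.toReal_ofReal (hft0 x), smul_eq_mul, hw]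
    rcases (hf0 x).eq_or_lt with h | h
    · simp [← h]
    · have := (hx h).ne'
      field_simp
  rw [hHSIC, hH₁, hH₂, hH₃, hH₄]
  simp only [key, integral_mul_const]
end

section
/- Let μ and μ̃ be Borel probability measures on ℝ^d with Lebesgue densities f and f̃ such that f̃(x) > 0 for Lebesgue-a.e. x with f(x) > 0, let w = f/f̃ (set to 0 where f̃ = 0), and assume w is μ̃-integrable with ∫ w dμ̃ = 1 (automatic since f is a density). Let X̃^{(1)}, …, X̃^{(n)} be i.i.d. with law μ̃, n ≥ 4, and set A_{ij} = l_k(X̃^{(i)}_k, X̃^{(j)}_k), B_{ij} = l(F(X̃^{(i)}), F(X̃^{(j)})), w_i = w(X̃^{(i)}). Then the modified U-statistic Ũ_n = (1/(n(n−1))) Σ_{i≠j} A_{ij} B_{ij} w_i w_j + (1/(n(n−1)(n−2)(n−3))) Σ_{(i,j,p,q) pairwise distinct} A_{ij} B_{pq} w_i w_j w_p w_q − (2/(n(n−1)(n−2))) Σ_{(i,j,r) pairwise distinct} A_{ij} B_{ir} w_i w_j w_r is an unbiased estimator of HSIC(X_k, Y): E[Ũ_n] = HSIC(X_k, Y). 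-/
open MeasureTheory
open scoped BigOperators

lemma aux_core {Ω S : Type*} [MeasurableSpace Ω] [MeasurableSpace S] {P : Measure Ω}
    {ρ α : Measure S} [IsFiniteMeasure α] {T : Ω → S} (hT : MeasurePreserving T P ρ)
    {u : S → ℝ} (hu : Measurable u) (hu0 : ∀ s, 0 ≤ u s)
    (hα : α = ρ.withDensity fun s => ENNReal.ofReal (u s))
    {G : S → ℝ} (hG : Measurable G) (C : ℝ) (hC : ∀ s, |G s| ≤ C) :
    Integrable (fun x => u (T x) * G (T x)) P ∧
      ∫ x, u (T x) * G (T x) ∂P = ∫ s, G s ∂α := by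
  have hint : Integrable G α :=
    Integrable.of_bound hG.aestronglyMeasurable C (Filter.Eventually.of_forall hC)
  have e : (fun s => (ENNReal.ofReal (u s)).toReal • G s) = fun s => u s * G s := by
    funext s
    rw [ENNReal.toReal_ofReal (hu0 s), smul_eq_mul]
  have hlt : ∀ᵐ s ∂ρ, ENNReal.ofReal (u s) < ⊤ :=
    Filter.Eventually.of_forall fun s => ENNReal.ofReal_lt_top
  have hm : Measurable fun s => u s * G s := hu.mul hG
  constructor
  · have h2 := hint
    rw [hα, integrable_withDensity_iff_integrable_smul' hu.ennreal_ofReal hlt, e] at h2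
    exact hT.integrable_comp_of_integrable h2
  · rw [hα, integral_withDensity_eq_integral_toReal_smul hu.ennreal_ofReal hlt]
    simp only [ENNReal.toReal_ofReal (hu0 _), smul_eq_mul]
    rw [← hT.map_eq, integral_map hT.aemeasurable hm.aestronglyMeasurable]

lemma aux_prod {S T : Type*} [MeasurableSpace S] [MeasurableSpace T]
    {ρ α : Measure S} {σ β : Measure T} [SFinite ρ] [SFinite σ] [SFinite β]
    {u : S → ℝ} {v : T → ℝ} (hu : Measurable u) (hv : Measurable v) (hu0 : ∀ s, 0 ≤ u s)
    (hα : α = ρ.withDensity fun s => ENNReal.ofReal (u s))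
    (hβ : β = σ.withDensity fun s => ENNReal.ofReal (v s)) :
    α.prod β = (ρ.prod σ).withDensity fun z => ENNReal.ofReal (u z.1 * v z.2) := by
  rw [hα, hβ, prod_withDensity hu.ennreal_ofReal hv.ennreal_ofReal]
  simp only [ENNReal.ofReal_mul (hu0 _)]

section
variable {E : Type*} [MeasurableSpace E] (ν : Measure E) [IsProbabilityMeasure ν] {n : ℕ}

lemma aux_indep : ProbabilityTheory.iIndepFun (fun (i : Fin n) (X : Fin n → E) => X i)
    (Measure.pi fun _ : Fin n => ν) :=
  ProbabilityTheory.iIndepFun_pi (X := fun _ => id) (μ := fun _ => ν) (fun _ => aemeasurable_id)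

lemma aux_mp {A B Ω : Type*} [MeasurableSpace A] [MeasurableSpace B] [MeasurableSpace Ω]
    {P : Measure Ω} [IsFiniteMeasure P] {a : Measure A} {b : Measure B} {f : Ω → A} {g : Ω → B}
    (hf : MeasurePreserving f P a) (hg : MeasurePreserving g P b)
    (h : ProbabilityTheory.IndepFun f g P) :
    MeasurePreserving (fun x => (f x, g x)) P (a.prod b) := by
  refine ⟨hf.measurable.prodMk hg.measurable, ?_⟩
  rw [h.map_prod_eq_prod_map_map hf.aemeasurable hg.aemeasurable, hf.map_eq, hg.map_eq]

lemma aux_mp1 (i : Fin n) :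
    MeasurePreserving (fun X : Fin n → E => X i) (Measure.pi fun _ : Fin n => ν) ν :=
  measurePreserving_eval (fun _ : Fin n => ν) i

lemma aux_mp2 {i j : Fin n} (h : i ≠ j) :
    MeasurePreserving (fun X : Fin n → E => (X i, X j)) (Measure.pi fun _ : Fin n => ν)
      (ν.prod ν) :=
  aux_mp (aux_mp1 ν i) (aux_mp1 ν j) ((aux_indep ν).indepFun h)

lemma aux_mp3 {i j r : Fin n} (h : i ≠ j) (h1 : i ≠ r) (h2 : j ≠ r) :
    MeasurePreserving (fun X : Fin n → E => ((X i, X j), X r)) (Measure.pi fun _ : Fin n => ν)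
      ((ν.prod ν).prod ν) :=
  aux_mp (aux_mp2 ν h) (aux_mp1 ν r)
    ((aux_indep ν).indepFun_prodMk (fun i => measurable_pi_apply i) i j r h1 h2)

lemma aux_mp4 {i j p q : Fin n} (h : i ≠ j) (h1 : i ≠ p) (h2 : i ≠ q) (h3 : j ≠ p) (h4 : j ≠ q)
    (h5 : p ≠ q) :
    MeasurePreserving (fun X : Fin n → E => ((X i, X j), (X p, X q)))
      (Measure.pi fun _ : Fin n => ν) ((ν.prod ν).prod (ν.prod ν)) :=
  aux_mp (aux_mp2 ν h) (aux_mp2 ν h5)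
    ((aux_indep ν).indepFun_prodMk_prodMk (fun i => measurable_pi_apply i) i j p q h1 h2 h3 h4)

end

lemma aux_count {n : ℕ} (s : Finset (Fin n)) (c : ℝ) :
    ∑ r, (if r ∈ s then 0 else c) = ((n : ℝ) - s.card) * c := by
  have h : ∀ r, (if r ∈ s then 0 else c) = c - (if r ∈ s then c else 0) := by
    intro r; split_ifs <;> simp
  simp only [h, Finset.sum_sub_distrib, Finset.sum_ite_mem]
  simp
  ring

lemma aux_count2 {n : ℕ} (c : ℝ) :
    ∑ i : Fin n, ∑ j : Fin n, (if i = j then 0 else c) = (n : ℝ) * ((n : ℝ) - 1) * c := by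
  have h : ∀ i : Fin n, ∑ j : Fin n, (if i = j then 0 else c) = ((n : ℝ) - 1) * c := by
    intro i
    have := aux_count {i} c
    simpa [eq_comm] using this
  simp only [h]
  simp
  ring

lemma aux_count3 {n : ℕ} (c : ℝ) :
    ∑ i : Fin n, ∑ j : Fin n, ∑ r : Fin n, (if i = j ∨ i = r ∨ j = r then 0 else c)
      = (n : ℝ) * ((n : ℝ) - 1) * ((n : ℝ) - 2) * c := by
  have h : ∀ i j : Fin n, ∑ r : Fin n, (if i = j ∨ i = r ∨ j = r then 0 else c)
      = if i = j then 0 else ((n : ℝ) - 2) * c := by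
    intro i j
    by_cases hij : i = j
    · simp [hij]
    · have := aux_count {i, j} c
      rw [Finset.card_pair hij] at this
      simpa [hij, eq_comm] using this
  simp only [h]
  rw [aux_count2]
  ring

lemma aux_count4 {n : ℕ} (c : ℝ) :
    ∑ i : Fin n, ∑ j : Fin n, ∑ p : Fin n, ∑ q : Fin n,
      (if i = j ∨ i = p ∨ i = q ∨ j = p ∨ j = q ∨ p = q then 0 else c)
      = (n : ℝ) * ((n : ℝ) - 1) * ((n : ℝ) - 2) * ((n : ℝ) - 3) * c := by
  have h : ∀ i j p : Fin n, ∑ q : Fin n,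
      (if i = j ∨ i = p ∨ i = q ∨ j = p ∨ j = q ∨ p = q then 0 else c)
      = if i = j ∨ i = p ∨ j = p then 0 else ((n : ℝ) - 3) * c := by
    intro i j p
    by_cases hij : i = j
    · simp [hij]
    by_cases hip : i = p
    · simp [hip]
    by_cases hjp : j = p
    · simp [hjp]
    have := aux_count {i, j, p} c
    rw [Finset.card_eq_three.2 ⟨i, j, p, hij, hip, hjp, rfl⟩] at this
    simpa [hij, hip, hjp, eq_comm] using this
  simp only [h]
  rw [aux_count3]
  ring

lemma aux_if {Ω : Type*} [MeasurableSpace Ω] {P : Measure Ω} {c : Prop} [Decidable c] {g : Ω → ℝ}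
    {a : ℝ} (h : ¬ c → Integrable g P ∧ ∫ x, g x ∂P = a) :
    Integrable (fun x => if c then 0 else g x) P ∧
      ∫ x, (if c then 0 else g x) ∂P = if c then 0 else a := by
  by_cases hc : c
  · simp [hc]
  · simpa [hc] using h hc

lemma aux_sum {Ω ι : Type*} [Fintype ι] [MeasurableSpace Ω] {P : Measure Ω} {g : ι → Ω → ℝ}
    {a : ι → ℝ} (h : ∀ i, Integrable (g i) P ∧ ∫ x, g i x ∂P = a i) :
    Integrable (fun x => ∑ i, g i x) P ∧ ∫ x, (∑ i, g i x) ∂P = ∑ i, a i := by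
  refine ⟨integrable_finsetSum _ fun i _ => (h i).1, ?_⟩
  rw [integral_finsetSum _ fun i _ => (h i).1]
  exact Finset.sum_congr rfl fun i _ => (h i).2

lemma aux_comb {Ω : Type*} [MeasurableSpace Ω] {P : Measure Ω} {f g h : Ω → ℝ} {x y z : ℝ}
    (a b c : ℝ) (hf : Integrable f P ∧ ∫ t, f t ∂P = x) (hg : Integrable g P ∧ ∫ t, g t ∂P = y)
    (hh : Integrable h P ∧ ∫ t, h t ∂P = z) :
    ∫ t, (a * f t + b * g t - c * h t) ∂P = a * x + b * y - c * z := by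
  have h1 : Integrable (fun t => a * f t + b * g t) P :=
    (hf.1.const_mul a).add (hg.1.const_mul b)
  rw [integral_sub h1 (hh.1.const_mul c), integral_add (hf.1.const_mul a) (hg.1.const_mul b),
    integral_const_mul, integral_const_mul, integral_const_mul, hf.2, hg.2, hh.2]

/-- The modified (importance-weighted) U-statistic built from an i.i.d. sample drawn
from the alternative law μ̃ is an unbiased estimator of HSIC(X_k, Y). -/
theorem modified_hsic_ustatistic_unbiased
    (d n : ℕ) (hn : 4 ≤ n) (k : Fin d)
    (F : (Fin d → ℝ) → ℝ) (hF : Measurable F)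
    (lk l : ℝ → ℝ → ℝ)
    (hlkm : Measurable (Function.uncurry lk)) (hlm : Measurable (Function.uncurry l))
    (Ck Cl : ℝ) (hlkB : ∀ a b, |lk a b| ≤ Ck) (hlB : ∀ a b, |l a b| ≤ Cl)
    (hlks : ∀ a b, lk a b = lk b a) (hls : ∀ a b, l a b = l b a)
    (f ftil : (Fin d → ℝ) → ℝ)
    (hfm : Measurable f) (hftm : Measurable ftil)
    (hf0 : ∀ x, 0 ≤ f x) (hft0 : ∀ x, 0 ≤ ftil x)
    (μ μtil : Measure (Fin d → ℝ))
    [IsProbabilityMeasure μ] [IsProbabilityMeasure μtil]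
    (hμ : μ = (volume : Measure (Fin d → ℝ)).withDensity fun x => ENNReal.ofReal (f x))
    (hμt : μtil = (volume : Measure (Fin d → ℝ)).withDensity fun x => ENNReal.ofReal (ftil x))
    (hsupp : ∀ᵐ x ∂(volume : Measure (Fin d → ℝ)), 0 < f x → 0 < ftil x)
    (w : (Fin d → ℝ) → ℝ) (hw : ∀ x, w x = f x / ftil x)
    (hwint : Integrable w μtil) (hwone : ∫ x, w x ∂μtil = 1) :
    -- expectation of the modified U-statistic over an i.i.d. n-sample from μ̃
    (∫ X : Fin n → (Fin d → ℝ),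
        ((1 / ((n : ℝ) * ((n : ℝ) - 1)))
            * ∑ i, ∑ j, (if i = j then 0 else
                lk (X i k) (X j k) * l (F (X i)) (F (X j)) * w (X i) * w (X j))
          + (1 / ((n : ℝ) * ((n : ℝ) - 1) * ((n : ℝ) - 2) * ((n : ℝ) - 3)))
            * ∑ i, ∑ j, ∑ p, ∑ q,
                (if i = j ∨ i = p ∨ i = q ∨ j = p ∨ j = q ∨ p = q then 0 else
                  lk (X i k) (X j k) * l (F (X p)) (F (X q))
                    * w (X i) * w (X j) * w (X p) * w (X q))
          - (2 / ((n : ℝ) * ((n : ℝ) - 1) * ((n : ℝ) - 2)))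
            * ∑ i, ∑ j, ∑ r,
                (if i = j ∨ i = r ∨ j = r then 0 else
                  lk (X i k) (X j k) * l (F (X i)) (F (X r))
                    * w (X i) * w (X j) * w (X r)))
        ∂(Measure.pi fun _ : Fin n => μtil))
      -- equals HSIC(X_k, Y) = H¹ + H²·H³ − 2·H⁴ under the original law μ
      = (∫ x, (∫ x', lk (x k) (x' k) * l (F x) (F x') ∂μ) ∂μ)
        + (∫ x, (∫ x', lk (x k) (x' k) ∂μ) ∂μ) * (∫ x, (∫ x', l (F x) (F x') ∂μ) ∂μ)
        - 2 * (∫ x, (∫ y, (∫ z, lk (x k) (y k) * l (F x) (F z) ∂μ) ∂μ) ∂μ) := by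
  have hwm : Measurable w := by
    rw [funext hw]; exact hfm.div hftm
  have hw0 : ∀ x, 0 ≤ w x := fun x => by rw [hw]; exact div_nonneg (hf0 x) (hft0 x)
  have hμw : μ = μtil.withDensity fun x => ENNReal.ofReal (w x) := by
    rw [hμ, hμt, ← withDensity_mul _ hftm.ennreal_ofReal hwm.ennreal_ofReal]
    refine withDensity_congr_ae ?_
    filter_upwards [hsupp] with x hx
    rw [Pi.mul_apply, ← ENNReal.ofReal_mul (hft0 x), hw]
    congr 1
    rcases (hf0 x).eq_or_lt with h | h
    · rw [← h]; simp
    · have := (hx h).ne'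
      field_simp
  have hμ2 := aux_prod hwm hwm hw0 hμw hμw
  have hw2m : Measurable fun z : (Fin d → ℝ) × (Fin d → ℝ) => w z.1 * w z.2 := by fun_prop
  have hw20 : ∀ z : (Fin d → ℝ) × (Fin d → ℝ), 0 ≤ w z.1 * w z.2 :=
    fun z => mul_nonneg (hw0 _) (hw0 _)
  have hμ3 := aux_prod hw2m hwm hw20 hμ2 hμw
  have hμ4 := aux_prod hw2m hw2m hw20 hμ2 hμ2
  have mlk : ∀ {S : Type} [MeasurableSpace S] {a b : S → ℝ}, Measurable a → Measurable b →
      Measurable fun s => lk (a s) (b s) := fun ha hb => hlkm.comp (ha.prodMk hb)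
  have ml : ∀ {S : Type} [MeasurableSpace S] {a b : S → ℝ}, Measurable a → Measurable b →
      Measurable fun s => l (a s) (b s) := fun ha hb => hlm.comp (ha.prodMk hb)
  have hb : ∀ a b a' b', |lk a b * l a' b'| ≤ Ck * Cl := fun a b a' b' => by
    rw [abs_mul]
    exact mul_le_mul (hlkB _ _) (hlB _ _) (abs_nonneg _) ((abs_nonneg _).trans (hlkB 0 0))
  have hbi : ∀ {S : Type} [MeasurableSpace S] (ρ : Measure S) [IsFiniteMeasure ρ] (G : S → ℝ)
      (C : ℝ), Measurable G → (∀ s, |G s| ≤ C) → Integrable G ρ := fun ρ _ G C hG hC =>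
    Integrable.of_bound hG.aestronglyMeasurable C (Filter.Eventually.of_forall hC)
  -- first term
  have t1 := aux_sum (P := Measure.pi fun _ : Fin n => μtil) (fun i : Fin n => aux_sum (fun j : Fin n =>
    aux_if (P := Measure.pi fun _ : Fin n => μtil) (c := i = j)
      (g := fun X => lk (X i k) (X j k) * l (F (X i)) (F (X j)) * w (X i) * w (X j))
      (a := ∫ x, (∫ x', lk (x k) (x' k) * l (F x) (F x') ∂μ) ∂μ) (fun hc => by
        have mG : Measurable fun z : (Fin d → ℝ) × (Fin d → ℝ) =>
            lk (z.1 k) (z.2 k) * l (F z.1) (F z.2) :=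
          (mlk (by fun_prop) (by fun_prop)).mul (ml (by fun_prop) (by fun_prop))
        have := aux_core (aux_mp2 μtil hc) hw2m hw20 hμ2 mG (Ck * Cl) (fun s => hb _ _ _ _)
        rw [integral_prod _ (hbi _ _ _ mG (fun s => hb _ _ _ _))] at this
        have e : (fun X : Fin n → (Fin d → ℝ) => lk (X i k) (X j k) * l (F (X i)) (F (X j))
                    * w (X i) * w (X j)) = fun X =>
            (w (X i) * w (X j)) * (lk (X i k) (X j k) * l (F (X i)) (F (X j))) := by
          funext X; ring
        rw [e]
        exact this)))
  have t2 := aux_sum (P := Measure.pi fun _ : Fin n => μtil) (fun i : Fin n =>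
    aux_sum (fun j : Fin n => aux_sum (fun p : Fin n => aux_sum (fun q : Fin n =>
    aux_if (P := Measure.pi fun _ : Fin n => μtil)
      (c := i = j ∨ i = p ∨ i = q ∨ j = p ∨ j = q ∨ p = q)
      (g := fun X => lk (X i k) (X j k) * l (F (X p)) (F (X q))
                    * w (X i) * w (X j) * w (X p) * w (X q))
      (a := (∫ x, (∫ x', lk (x k) (x' k) ∂μ) ∂μ) * (∫ x, (∫ x', l (F x) (F x') ∂μ) ∂μ))
      (fun hc => by
        simp only [not_or] at hc
        obtain ⟨c1, c2, c3, c4, c5, c6⟩ := hc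
        have m1 : Measurable fun z : (Fin d → ℝ) × (Fin d → ℝ) => lk (z.1 k) (z.2 k) :=
          mlk (by fun_prop) (by fun_prop)
        have m2 : Measurable fun z : (Fin d → ℝ) × (Fin d → ℝ) => l (F z.1) (F z.2) :=
          ml (by fun_prop) (by fun_prop)
        have mG : Measurable fun z : ((Fin d → ℝ) × (Fin d → ℝ)) × ((Fin d → ℝ) × (Fin d → ℝ)) =>
            lk (z.1.1 k) (z.1.2 k) * l (F z.2.1) (F z.2.2) :=
          (m1.comp measurable_fst).mul (m2.comp measurable_snd)
        have := aux_core (aux_mp4 μtil c1 c2 c3 c4 c5 c6)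
          ((hw2m.comp measurable_fst).mul (hw2m.comp measurable_snd))
          (fun s => mul_nonneg (hw20 _) (hw20 _)) hμ4 mG (Ck * Cl) (fun s => hb _ _ _ _)
        rw [integral_prod_mul (fun z : (Fin d → ℝ) × (Fin d → ℝ) => lk (z.1 k) (z.2 k))
          (fun z : (Fin d → ℝ) × (Fin d → ℝ) => l (F z.1) (F z.2)),
          integral_prod _ (hbi _ _ _ m1 (fun s => hlkB _ _)),
          integral_prod _ (hbi _ _ _ m2 (fun s => hlB _ _))] at this
        have e : (fun X : Fin n → (Fin d → ℝ) => lk (X i k) (X j k) * l (F (X p)) (F (X q))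
                    * w (X i) * w (X j) * w (X p) * w (X q)) = fun X =>
            (w (X i) * w (X j)) * (w (X p) * w (X q)) *
              (lk (X i k) (X j k) * l (F (X p)) (F (X q))) := by
          funext X; ring
        rw [e]
        exact this)))))
  have t3 := aux_sum (P := Measure.pi fun _ : Fin n => μtil) (fun i : Fin n =>
    aux_sum (fun j : Fin n => aux_sum (fun r : Fin n =>
    aux_if (P := Measure.pi fun _ : Fin n => μtil)
      (c := i = j ∨ i = r ∨ j = r)
      (g := fun X => lk (X i k) (X j k) * l (F (X i)) (F (X r))
                    * w (X i) * w (X j) * w (X r))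
      (a := ∫ x, (∫ y, (∫ z, lk (x k) (y k) * l (F x) (F z) ∂μ) ∂μ) ∂μ)
      (fun hc => by
        simp only [not_or] at hc
        obtain ⟨c1, c2, c3⟩ := hc
        have mG : Measurable fun z : ((Fin d → ℝ) × (Fin d → ℝ)) × (Fin d → ℝ) =>
            lk (z.1.1 k) (z.1.2 k) * l (F z.1.1) (F z.2) :=
          (mlk (by fun_prop) (by fun_prop)).mul (ml (by fun_prop) (by fun_prop))
        have hi := hbi ((μ.prod μ).prod μ) _ _ mG (fun s => hb _ _ _ _)
        have := aux_core (aux_mp3 μtil c1 c2 c3)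
          ((hw2m.comp measurable_fst).mul (hwm.comp measurable_snd))
          (fun s => mul_nonneg (hw20 _) (hw0 _)) hμ3 mG (Ck * Cl) (fun s => hb _ _ _ _)
        rw [integral_prod _ hi, integral_prod _ hi.integral_prod_left] at this
        have e : (fun X : Fin n → (Fin d → ℝ) => lk (X i k) (X j k) * l (F (X i)) (F (X r))
                    * w (X i) * w (X j) * w (X r)) = fun X =>
            (w (X i) * w (X j)) * w (X r) *
              (lk (X i k) (X j k) * l (F (X i)) (F (X r))) := by
          funext X; ring
        rw [e]
        exact this))))
  rw [aux_count2] at t1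
  rw [aux_count4] at t2
  rw [aux_count3] at t3
  refine (aux_comb _ _ _ t1 t2 t3).trans ?_
  have hn' : (4 : ℝ) ≤ n := by exact_mod_cast hn
  have n0 : (n : ℝ) ≠ 0 := by linarith
  have n1 : (n : ℝ) - 1 ≠ 0 := by intro h; linarith
  have n2 : (n : ℝ) - 2 ≠ 0 := by intro h; linarith
  have n3 : (n : ℝ) - 3 ≠ 0 := by intro h; linarith
  field_simp
end

section
/- (Proposition 2, bias of the modified HSIC estimator) Assume the product and independence-hypothesis setting (H_{0,k}) and that l_k(u,u) = 1 and l(y,y) = 1 for all u, y. Let X̃^{(1)}, X̃^{(2)}, … be i.i.d. with law μ̃ and let H̃SIC_n be the modified V-statistic estimator built from the first n points. Then HSIC(X_k, Y) = 0 and n · E[H̃SIC_n] converges, as n → ∞, to 2 (E_ω^k − E_{x_k,ω})(E_ω^{−k} − E_{y,ω}) − (E_ω − E_{x_k})(E_ω − E_y) + E_ω (E_ω − 1); in particular the estimator is asymptotically unbiased and its bias is O(1/n). -/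
open MeasureTheory Filter
open scoped BigOperators

set_option linter.unusedSimpArgs false

theorem aux_lim (x : ℕ → ℝ) (L B : ℝ) (h : ∀ n : ℕ, 0 < n → |x n - L| ≤ B / n) :
    Tendsto x atTop (nhds L) := by
  rw [tendsto_iff_norm_sub_tendsto_zero]
  refine squeeze_zero' (Eventually.of_forall fun _ => norm_nonneg _) ?_
    (tendsto_const_div_atTop_nhds_zero_nat B)
  filter_upwards [eventually_gt_atTop 0] with n hn using h n hn

theorem lim4 (T : ∀ n : ℕ, Fin n → Fin n → Fin n → Fin n → ℝ) (B a b1 b2 b3 b4 b5 b6 : ℝ)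
    (hB : ∀ n i j p q, |T n i j p q| ≤ B)
    (h0 : ∀ n i j p q, i ≠ j → i ≠ p → i ≠ q → j ≠ p → j ≠ q → p ≠ q → T n i j p q = a)
    (h1 : ∀ n i p q, i ≠ p → i ≠ q → p ≠ q → T n i i p q = b1)
    (h2 : ∀ n i j p, i ≠ j → i ≠ p → j ≠ p → T n i j p p = b2)
    (h3 : ∀ n i j q, i ≠ j → i ≠ q → j ≠ q → T n i j i q = b3)
    (h4 : ∀ n i j p, i ≠ j → i ≠ p → j ≠ p → T n i j p i = b4)
    (h5 : ∀ n i j q, i ≠ j → i ≠ q → j ≠ q → T n i j j q = b5)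
    (h6 : ∀ n i j p, i ≠ j → i ≠ p → j ≠ p → T n i j p j = b6) :
    Tendsto (fun n : ℕ => (n : ℝ) * ((1 / (n : ℝ) ^ 4) * (∑ i, ∑ j, ∑ p, ∑ q, T n i j p q) - a))
      atTop (nhds (b1 + b2 + b3 + b4 + b5 + b6 - 6 * a)) := by
  set B' := B + |a| + |b1 - a| + |b2 - a| + |b3 - a| + |b4 - a| + |b5 - a| + |b6 - a| with hB'
  apply aux_lim _ _ (7 * B')
  intro n hn
  let T0 : Fin n → Fin n → Fin n → Fin n → ℝ := fun i j p q =>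
    a + (if i = j then b1 - a else 0) + (if p = q then b2 - a else 0)
      + (if i = p then b3 - a else 0) + (if i = q then b4 - a else 0)
      + (if j = p then b5 - a else 0) + (if j = q then b6 - a else 0)
  let R : Fin n → Fin n → Fin n → Fin n → ℝ := fun i j p q =>
    (if i = j then if p = q then 1 else 0 else 0) + (if i = p then if j = q then 1 else 0 else 0)
    + (if i = q then if j = p then 1 else 0 else 0) + (if i = j then if i = p then 1 else 0 else 0)
    + (if i = j then if i = q then 1 else 0 else 0) + (if i = p then if i = q then 1 else 0 else 0)
    + (if j = p then if j = q then 1 else 0 else 0)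
  have hT0 : ∑ i, ∑ j, ∑ p, ∑ q, T0 i j p q
      = a * n ^ 4 + (b1 - a + (b2 - a) + (b3 - a) + (b4 - a) + (b5 - a) + (b6 - a)) * n ^ 3 := by
    simp only [T0, Finset.sum_add_distrib, Finset.sum_const, Finset.sum_ite_eq,
      Finset.mem_univ, if_true, Finset.card_univ, Fintype.card_fin, nsmul_eq_mul,
      Finset.sum_ite_irrel, Finset.sum_const_zero, ← Finset.mul_sum]
    ring
  have hR : ∑ i, ∑ j, ∑ p, ∑ q, R i j p q = 7 * n ^ 2 := by
    simp only [R, Finset.sum_add_distrib, Finset.sum_const, Finset.sum_ite_eq,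
      Finset.mem_univ, if_true, Finset.card_univ, Fintype.card_fin, nsmul_eq_mul,
      Finset.sum_ite_irrel, Finset.sum_const_zero, ← Finset.mul_sum]
    simp
    try ring
  have hB0 : 0 ≤ B := (abs_nonneg _).trans (hB 1 0 0 0 0)
  have hB'0 : 0 ≤ B' := by positivity
  have hT0B : ∀ i j p q, |T0 i j p q| ≤ B' - B := by
    intro i j p q
    have hi : ∀ (P : Prop) [Decidable P] (z : ℝ), |if P then z else 0| ≤ |z| := by
      intro P _ z; split_ifs <;> simp
    have e1 := hi (i = j) (b1 - a)
    have e2 := hi (p = q) (b2 - a)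
    have e3 := hi (i = p) (b3 - a)
    have e4 := hi (i = q) (b4 - a)
    have e5 := hi (j = p) (b5 - a)
    have e6 := hi (j = q) (b6 - a)
    simp only [T0]
    refine (abs_add_le _ _).trans ?_
    refine (add_le_add_left (abs_add_le _ _) _).trans ?_
    refine (add_le_add_left (add_le_add_left (abs_add_le _ _) _) _).trans ?_
    refine (add_le_add_left (add_le_add_left (add_le_add_left (abs_add_le _ _) _) _) _).trans ?_
    refine (add_le_add_left (add_le_add_left (add_le_add_left (add_le_add_left (abs_add_le _ _) _) _) _) _).trans ?_
    refine (add_le_add_left (add_le_add_left (add_le_add_left (add_le_add_left (add_le_add_left (abs_add_le _ _) _) _) _) _) _).trans ?_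
    linarith
  have hpt : ∀ i j p q, |T n i j p q - T0 i j p q| ≤ B' * R i j p q := by
    intro i j p q
    have hgen : |T n i j p q - T0 i j p q| ≤ B' := by
      have := hB n i j p q
      have := hT0B i j p q
      have := abs_sub (T n i j p q) (T0 i j p q)
      linarith
    have hR0 : 0 ≤ R i j p q := by
      simp only [R]; positivity
    by_cases h : 1 ≤ R i j p q
    · nlinarith
    · have : T n i j p q = T0 i j p q := by
        clear hgen hT0 hR hT0B
        simp only [R] at h
        simp only [T0]
        by_cases c1 : i = j
        · subst c1
          by_cases c2 : i = p
          · subst c2; exfalso; apply h; simp only [↓reduceIte]; split_ifs <;> norm_num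
          by_cases c3 : i = q
          · subst c3; exfalso; apply h; simp only [↓reduceIte]; split_ifs <;> norm_num
          by_cases c4 : p = q
          · subst c4; exfalso; apply h; simp only [↓reduceIte]; split_ifs <;> norm_num
          rw [h1 n i p q c2 c3 c4]; simp [c2, c3, c4]
        by_cases c2 : i = p
        · subst c2
          by_cases c3 : i = q
          · subst c3; exfalso; apply h; simp only [↓reduceIte]; split_ifs <;> norm_num
          by_cases c4 : j = q
          · subst c4; exfalso; apply h; simp only [↓reduceIte]; split_ifs <;> norm_num
          rw [h3 n i j q c1 c3 c4]; simp [c1, c3, c4, Ne.symm c1]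
        by_cases c3 : i = q
        · subst c3
          by_cases c4 : j = p
          · subst c4; exfalso; apply h; simp only [↓reduceIte]; split_ifs <;> norm_num
          rw [h4 n i j p c1 c2 c4]; simp [c1, c2, c4, Ne.symm c1, Ne.symm c2]
        by_cases c4 : j = p
        · subst c4
          by_cases c5 : j = q
          · subst c5; exfalso; apply h; simp only [↓reduceIte]; split_ifs <;> norm_num
          rw [h5 n i j q c1 c3 c5]; simp [c1, c3, c5]
        by_cases c5 : j = q
        · subst c5
          rw [h6 n i j p c1 c2 c4]; simp [c1, c2, c4, Ne.symm c4]
        by_cases c6 : p = q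
        · subst c6
          rw [h2 n i j p c1 c2 c4]; simp [c1, c2, c4]
        rw [h0 n i j p q c1 c2 c3 c4 c5 c6]; simp [c1, c2, c3, c4, c5, c6]
      rw [this]; simp; positivity
  have hsum : |∑ i, ∑ j, ∑ p, ∑ q, T n i j p q - ∑ i, ∑ j, ∑ p, ∑ q, T0 i j p q|
      ≤ B' * (7 * n ^ 2) := by
    rw [← hR]
    simp only [← Finset.sum_sub_distrib, Finset.mul_sum]
    refine (Finset.abs_sum_le_sum_abs _ _).trans (Finset.sum_le_sum fun i _ => ?_)
    refine (Finset.abs_sum_le_sum_abs _ _).trans (Finset.sum_le_sum fun j _ => ?_)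
    refine (Finset.abs_sum_le_sum_abs _ _).trans (Finset.sum_le_sum fun p _ => ?_)
    refine (Finset.abs_sum_le_sum_abs _ _).trans (Finset.sum_le_sum fun q _ => ?_)
    exact hpt i j p q
  rw [hT0] at hsum
  have hn' : (0 : ℝ) < n := by exact_mod_cast hn
  set S := ∑ i, ∑ j, ∑ p, ∑ q, T n i j p q
  have : (n : ℝ) * ((1 / (n : ℝ) ^ 4) * S - a) - (b1 + b2 + b3 + b4 + b5 + b6 - 6 * a)
     = (S - (a * n ^ 4 + (b1 - a + (b2 - a) + (b3 - a) + (b4 - a) + (b5 - a) + (b6 - a)) * n ^ 3)) / n ^ 3 := by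
    field_simp; ring
  rw [this, abs_div, abs_of_pos (by positivity : (0:ℝ) < n ^ 3), div_le_div_iff₀ (by positivity) hn']
  calc _ ≤ B' * (7 * n ^ 2) * n := by gcongr
    _ = _ := by ring

theorem lim3 (T : ∀ n : ℕ, Fin n → Fin n → Fin n → ℝ) (B a b1 b2 b3 : ℝ)
    (hB : ∀ n i j p, |T n i j p| ≤ B)
    (h0 : ∀ n i j p, i ≠ j → i ≠ p → j ≠ p → T n i j p = a)
    (h1 : ∀ n i p, i ≠ p → T n i i p = b1)
    (h2 : ∀ n i j, i ≠ j → T n i j i = b2)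
    (h3 : ∀ n i j, i ≠ j → T n i j j = b3) :
    Tendsto (fun n : ℕ => (n : ℝ) * ((1 / (n : ℝ) ^ 3) * (∑ i, ∑ j, ∑ p, T n i j p) - a))
      atTop (nhds (b1 + b2 + b3 - 3 * a)) := by
  set B' := B + |a| + |b1 - a| + |b2 - a| + |b3 - a| with hB'
  apply aux_lim _ _ B'
  intro n hn
  let T0 : Fin n → Fin n → Fin n → ℝ := fun i j p =>
    a + (if i = j then b1 - a else 0) + (if i = p then b2 - a else 0)
      + (if j = p then b3 - a else 0)
  let R : Fin n → Fin n → Fin n → ℝ := fun i j p => if i = j then if i = p then 1 else 0 else 0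
  have hT0 : ∑ i, ∑ j, ∑ p, T0 i j p
      = a * n ^ 3 + (b1 - a + (b2 - a) + (b3 - a)) * n ^ 2 := by
    simp only [T0, Finset.sum_add_distrib, Finset.sum_const, Finset.sum_ite_eq,
      Finset.mem_univ, if_true, Finset.card_univ, Fintype.card_fin, nsmul_eq_mul,
      Finset.sum_ite_irrel, Finset.sum_const_zero, ← Finset.mul_sum]
    ring
  have hR : ∑ i, ∑ j, ∑ p, R i j p = n := by
    simp only [R, Finset.sum_add_distrib, Finset.sum_const, Finset.sum_ite_eq,
      Finset.mem_univ, if_true, Finset.card_univ, Fintype.card_fin, nsmul_eq_mul,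
      Finset.sum_ite_irrel, Finset.sum_const_zero, ← Finset.mul_sum]
    simp
    try ring
  have hB0 : 0 ≤ B := (abs_nonneg _).trans (hB 1 0 0 0)
  have hB'0 : 0 ≤ B' := by positivity
  have hT0B : ∀ i j p, |T0 i j p| ≤ B' - B := by
    intro i j p
    have hi : ∀ (P : Prop) [Decidable P] (z : ℝ), |if P then z else 0| ≤ |z| := by
      intro P _ z; split_ifs <;> simp
    have e1 := hi (i = j) (b1 - a)
    have e3 := hi (i = p) (b2 - a)
    have e5 := hi (j = p) (b3 - a)
    simp only [T0]
    refine (abs_add_le _ _).trans ?_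
    refine (add_le_add_left (abs_add_le _ _) _).trans ?_
    refine (add_le_add_left (add_le_add_left (abs_add_le _ _) _) _).trans ?_
    linarith
  have hpt : ∀ i j p, |T n i j p - T0 i j p| ≤ B' * R i j p := by
    intro i j p
    have hgen : |T n i j p - T0 i j p| ≤ B' := by
      have := hB n i j p
      have := hT0B i j p
      have := abs_sub (T n i j p) (T0 i j p)
      linarith
    simp only [R]
    by_cases c1 : i = j
    · subst c1
      by_cases c2 : i = p
      · subst c2; simpa using hgen
      simp [T0, h1 n i p c2, c2]
    by_cases c2 : i = p
    · subst c2
      simp [T0, h2 n i j c1, c1, Ne.symm c1]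
    by_cases c3 : j = p
    · subst c3
      simp [T0, h3 n i j c1, c1]
    simp [T0, h0 n i j p c1 c2 c3, c1, c2, c3]
  have hsum : |∑ i, ∑ j, ∑ p, T n i j p - ∑ i, ∑ j, ∑ p, T0 i j p| ≤ B' * n := by
    rw [← hR]
    simp only [← Finset.sum_sub_distrib, Finset.mul_sum]
    refine (Finset.abs_sum_le_sum_abs _ _).trans (Finset.sum_le_sum fun i _ => ?_)
    refine (Finset.abs_sum_le_sum_abs _ _).trans (Finset.sum_le_sum fun j _ => ?_)
    refine (Finset.abs_sum_le_sum_abs _ _).trans (Finset.sum_le_sum fun p _ => ?_)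
    exact hpt i j p
  rw [hT0] at hsum
  have hn' : (0 : ℝ) < n := by exact_mod_cast hn
  set S := ∑ i, ∑ j, ∑ p, T n i j p
  have : (n : ℝ) * ((1 / (n : ℝ) ^ 3) * S - a) - (b1 + b2 + b3 - 3 * a)
     = (S - (a * n ^ 3 + (b1 - a + (b2 - a) + (b3 - a)) * n ^ 2)) / n ^ 2 := by
    field_simp; ring
  rw [this, abs_div, abs_of_pos (by positivity : (0:ℝ) < n ^ 2), div_le_div_iff₀ (by positivity) hn']
  calc _ ≤ B' * n * n := by gcongr
    _ = _ := by ring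

theorem lim2 (T : ∀ n : ℕ, Fin n → Fin n → ℝ) (a b1 : ℝ)
    (h0 : ∀ n i j, i ≠ j → T n i j = a)
    (h1 : ∀ n i, T n i i = b1) :
    Tendsto (fun n : ℕ => (n : ℝ) * ((1 / (n : ℝ) ^ 2) * (∑ i, ∑ j, T n i j) - a))
      atTop (nhds (b1 - a)) := by
  apply aux_lim _ _ 0
  intro n hn
  have : ∀ i j, T n i j = a + (if i = j then b1 - a else 0) := by
    intro i j
    by_cases c : i = j
    · subst c; simp [h1]
    · simp [h0 n i j c, c]
  simp only [this, Finset.sum_add_distrib, Finset.sum_const, Finset.sum_ite_eq,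
      Finset.mem_univ, if_true, Finset.card_univ, Fintype.card_fin, nsmul_eq_mul]
  have hn' : (0 : ℝ) < n := by exact_mod_cast hn
  rw [zero_div, abs_nonpos_iff]
  field_simp; ring
set_option linter.unusedSectionVars false

section gen
variable {S : Type*} [MeasurableSpace S] (ν : Measure S) [IsProbabilityMeasure ν]

theorem L22 (n : ℕ) (H H' : S → S → ℝ) (hH : Measurable (Function.uncurry H))
    (hH' : Measurable (Function.uncurry H')) (i j p q : Fin n)
    (h1 : i ≠ p) (h2 : i ≠ q) (h3 : j ≠ p) (h4 : j ≠ q) :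
    ∫ s : Fin n → S, H (s i) (s j) * H' (s p) (s q) ∂(Measure.pi fun _ => ν)
      = (∫ s : Fin n → S, H (s i) (s j) ∂(Measure.pi fun _ => ν))
        * ∫ s : Fin n → S, H' (s p) (s q) ∂(Measure.pi fun _ => ν) := by
  have hi : ProbabilityTheory.iIndepFun (fun (i : Fin n) (s : Fin n → S) => s i)
      (Measure.pi fun _ => ν) :=
    ProbabilityTheory.iIndepFun_pi (μ := fun _ : Fin n => ν) (X := fun _ x => x)
      (fun _ => aemeasurable_id)
  have h := (hi.indepFun_prodMk_prodMk (fun i => measurable_pi_apply i) i j p q h1 h2 h3 h4).comp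
    hH hH'
  refine h.integral_fun_mul_eq_mul_integral ?_ ?_
  · exact (hH.comp (by fun_prop)).aestronglyMeasurable
  · exact (hH'.comp (by fun_prop)).aestronglyMeasurable

theorem L1 (n : ℕ) (h : S → ℝ) (i : Fin n) (hm : Measurable h) :
    ∫ s : Fin n → S, h (s i) ∂(Measure.pi fun _ => ν) = ∫ u, h u ∂ν := by
  have := (measurePreserving_eval (fun _ : Fin n => ν) i)
  have h2 := integral_map this.measurable.aemeasurable
    (hm.aestronglyMeasurable (μ := Measure.map (Function.eval i) (Measure.pi fun _ : Fin n => ν)))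
  rw [this.map_eq] at h2
  exact h2.symm

theorem L2 (n : ℕ) (H : S → S → ℝ) (B : ℝ) (hB : ∀ a b, |H a b| ≤ B)
    (hH : Measurable (Function.uncurry H)) (i j : Fin n) (h1 : i ≠ j) :
    ∫ s : Fin n → S, H (s i) (s j) ∂(Measure.pi fun _ => ν) = ∫ u, ∫ v, H u v ∂ν ∂ν := by
  have hi : ProbabilityTheory.iIndepFun (fun (i : Fin n) (s : Fin n → S) => s i)
      (Measure.pi fun _ => ν) :=
    ProbabilityTheory.iIndepFun_pi (μ := fun _ : Fin n => ν) (X := fun _ x => x)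
      (fun _ => aemeasurable_id)
  have h := hi.indepFun h1
  rw [ProbabilityTheory.indepFun_iff_map_prod_eq_prod_map_map
    (measurable_pi_apply i).aemeasurable (measurable_pi_apply j).aemeasurable] at h
  have e : ∀ i, Measure.map (fun s : Fin n → S => s i) (Measure.pi fun _ => ν) = ν := fun i =>
    (measurePreserving_eval (fun _ : Fin n => ν) i).map_eq
  rw [e, e] at h
  have hint : Integrable (Function.uncurry H) (ν.prod ν) :=
    Integrable.of_bound hH.aestronglyMeasurable B (ae_of_all _ fun x => hB x.1 x.2)
  refine Eq.trans ?_ (integral_prod (Function.uncurry H) hint)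
  rw [← h, integral_map (by fun_prop) hH.aestronglyMeasurable]
  rfl

theorem bdd_int {Ω : Type*} [MeasurableSpace Ω] (P : Measure Ω) [IsProbabilityMeasure P]
    (f : Ω → ℝ) (B : ℝ) (hB : ∀ x, |f x| ≤ B) : |∫ x, f x ∂P| ≤ B := by
  have := norm_integral_le_of_norm_le_const (μ := P) (f := f) (C := B) (ae_of_all _ hB)
  simpa using this

noncomputable def QQ (K : S → S → ℝ) (g : S → ℝ) (n : ℕ) (i j : Fin n) : ℝ :=
  ∫ s : Fin n → S, K (s i) (s j) * g (s i) * g (s j) ∂(Measure.pi fun _ => ν)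
noncomputable def NN (K : S → S → ℝ) (g : S → ℝ) (n : ℕ) (i j r : Fin n) : ℝ :=
  ∫ s : Fin n → S, K (s i) (s j) * g (s i) * g (s j) * g (s r) ∂(Measure.pi fun _ => ν)
noncomputable def MM (K : S → S → ℝ) (g : S → ℝ) (n : ℕ) (i j p q : Fin n) : ℝ :=
  ∫ s : Fin n → S, K (s i) (s j) * g (s i) * g (s j) * g (s p) * g (s q)
    ∂(Measure.pi fun _ => ν)

variable (K : S → S → ℝ) (g : S → ℝ) (BK Bg : ℝ)
  (hK : Measurable (Function.uncurry K)) (hg : Measurable g)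
  (hKB : ∀ a b, |K a b| ≤ BK) (hgB : ∀ a, |g a| ≤ Bg)
  (hKs : ∀ a b, K a b = K b a) (hKd : ∀ a, K a a = 1) (hg1 : ∫ u, g u ∂ν = 1)

include hKB hgB in
theorem b2 (a b : S) : |K a b * g a * g b| ≤ BK * Bg * Bg := by
  have := (abs_nonneg _).trans (hKB a b)
  have := (abs_nonneg _).trans (hgB a)
  rw [abs_mul, abs_mul]
  gcongr <;> apply_assumption

include hKB hgB in
theorem b3 (a b c : S) : |K a b * g a * g b * g c| ≤ BK * Bg * Bg * Bg := by
  have := (abs_nonneg _).trans (hKB a b)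
  have := (abs_nonneg _).trans (hgB a)
  rw [abs_mul, abs_mul, abs_mul]
  gcongr <;> apply_assumption

include hKB hgB in
theorem b4 (a b c d : S) : |K a b * g a * g b * g c * g d| ≤ BK * Bg * Bg * Bg * Bg := by
  have := (abs_nonneg _).trans (hKB a b)
  have := (abs_nonneg _).trans (hgB a)
  rw [abs_mul, abs_mul, abs_mul, abs_mul]
  gcongr <;> apply_assumption

include hK hg in
theorem mK (n : ℕ) (i j : Fin n) : Measurable (fun s : Fin n → S => K (s i) (s j)) :=
  hK.comp (f := fun s : Fin n → S => (s i, s j)) (by fun_prop)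

include hK hg hKB hgB in
theorem QQ_ne (n : ℕ) (i j : Fin n) (h : i ≠ j) :
    QQ ν K g n i j = ∫ u, ∫ v, K u v * g u * g v ∂ν ∂ν := by
  unfold QQ
  apply L2 ν n (fun a b => K a b * g a * g b) _ (b2 K g BK Bg hKB hgB) _ i j h
  exact (hK.mul (hg.comp measurable_fst)).mul (hg.comp measurable_snd)

include hg hKd in
theorem QQ_eq (n : ℕ) (i : Fin n) :
    QQ ν K g n i i = ∫ u, g u ^ 2 ∂ν := by
  unfold QQ
  rw [← L1 ν n (fun u => g u ^ 2) i (by fun_prop)]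
  simp [hKd, sq]

include hg hg1 in
theorem gg_ne (n : ℕ) (i j : Fin n) (h : i ≠ j) :
    ∫ s : Fin n → S, g (s i) * g (s j) ∂(Measure.pi fun _ => ν) = 1 := by
  rw [L22 ν n (fun a _ => g a) (fun a _ => g a) (hg.comp measurable_fst) (hg.comp measurable_fst)
    i i j j h h h h, L1 ν n g i hg, L1 ν n g j hg, hg1, one_mul]

include hg in
theorem gg_eq (n : ℕ) (i : Fin n) :
    ∫ s : Fin n → S, g (s i) * g (s i) ∂(Measure.pi fun _ => ν) = ∫ u, g u ^ 2 ∂ν := by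
  rw [← L1 ν n (fun u => g u ^ 2) i (by fun_prop)]
  simp [sq]

include hK hg in
theorem MM_disj (n : ℕ) (i j p q : Fin n)
    (h1 : i ≠ p) (h2 : i ≠ q) (h3 : j ≠ p) (h4 : j ≠ q) :
    MM ν K g n i j p q = QQ ν K g n i j *
      ∫ s : Fin n → S, g (s p) * g (s q) ∂(Measure.pi fun _ => ν) := by
  unfold MM QQ
  rw [← L22 ν n (fun a b => K a b * g a * g b) (fun a b => g a * g b)
    ((hK.mul (hg.comp measurable_fst)).mul (hg.comp measurable_snd))
    ((hg.comp measurable_fst).mul (hg.comp measurable_snd)) i j p q h1 h2 h3 h4]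
  simp only [mul_assoc]

include hKs in
theorem MM_swap1 (n : ℕ) (i j p q : Fin n) : MM ν K g n i j p q = MM ν K g n j i p q := by
  unfold MM
  congr 1; ext s; rw [hKs]; ring

theorem MM_swap2 (n : ℕ) (i j p q : Fin n) : MM ν K g n i j p q = MM ν K g n i j q p := by
  unfold MM
  congr 1; ext s; ring

include hK hg hg1 in
theorem NN_disj (n : ℕ) (i j r : Fin n) (h1 : i ≠ r) (h3 : j ≠ r) :
    NN ν K g n i j r = QQ ν K g n i j := by
  unfold NN QQ
  rw [L22 ν n (fun a b => K a b * g a * g b) (fun a _ => g a)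
    ((hK.mul (hg.comp measurable_fst)).mul (hg.comp measurable_snd))
    (hg.comp measurable_fst) i j r r h1 h1 h3 h3, L1 ν n g r hg, hg1, mul_one]

include hKs in
theorem NN_swap (n : ℕ) (i j r : Fin n) : NN ν K g n i j r = NN ν K g n j i r := by
  unfold NN
  congr 1; ext s; rw [hKs]; ring

include hK hg hKB hgB in
theorem NN_c (n : ℕ) (i j : Fin n) (h : i ≠ j) :
    NN ν K g n i j i = ∫ u, ∫ v, K u v * g u ^ 2 * g v ∂ν ∂ν := by
  unfold NN
  rw [← L2 ν n (fun a b => K a b * g a ^ 2 * g b) (BK * Bg * Bg * Bg) _ _ i j h]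
  · congr 1; ext s; ring
  · intro a b
    have := b3 K g BK Bg hKB hgB a b a
    convert this using 2; ring
  · exact (hK.mul ((hg.comp measurable_fst).pow_const 2)).mul (hg.comp measurable_snd)

include hK hg hg1 in
theorem MM_c (n : ℕ) (i j q : Fin n) (h1 : i ≠ q) (h3 : j ≠ q) :
    MM ν K g n i j i q = NN ν K g n i j i := by
  unfold MM NN
  rw [L22 ν n (fun a b => K a b * g a * g b * g a) (fun a _ => g a)
    (((hK.mul (hg.comp measurable_fst)).mul (hg.comp measurable_snd)).mul (hg.comp measurable_fst))
    (hg.comp measurable_fst) i j q q h1 h1 h3 h3, L1 ν n g q hg, hg1, mul_one]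

end gen

theorem exists_split (d : ℕ) (k : Fin d) :
    ∃ e : (Fin d → ℝ) ≃ᵐ ℝ × ({r : Fin d // r ≠ k} → ℝ),
      (∀ x, e x = (x k, fun r => x r.1)) ∧
      ∀ (m : Fin d → Measure ℝ) [∀ r, IsProbabilityMeasure (m r)],
        MeasurePreserving e (Measure.pi m) ((m k).prod (Measure.pi fun r => m r.1)) := by
  refine ⟨(MeasurableEquiv.piEquivPiSubtypeProd (fun _ => ℝ) (fun r => r = k)).trans
    (MeasurableEquiv.prodCongr (MeasurableEquiv.piUnique _) (MeasurableEquiv.refl _)), ?_, ?_⟩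
  · intro x; rfl
  · intro m _
    have h1 := measurePreserving_piEquivPiSubtypeProd m (fun r => r = k)
    have h2 := (@measurePreserving_piUnique _ (Subtype.fintype fun r => r = k) _ _ _
      (fun i : {r // r = k} => m i.1)).prod
      (MeasurePreserving.id (Measure.pi fun r : {r // ¬ r = k} => m r.1))
    exact h2.comp h1

theorem exists_split_n (d : ℕ) (k : Fin d) (n : ℕ) :
    ∃ e : (Fin n → Fin d → ℝ) ≃ᵐ (Fin n → ℝ) × (Fin n → {r : Fin d // r ≠ k} → ℝ),
      (∀ X, e X = (fun i => X i k, fun i r => X i r.1)) ∧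
      ∀ (m : Fin d → Measure ℝ) [∀ r, IsProbabilityMeasure (m r)],
        MeasurePreserving e (Measure.pi fun _ => Measure.pi m)
          ((Measure.pi fun _ => m k).prod (Measure.pi fun _ => Measure.pi fun r => m r.1)) := by
  obtain ⟨e, he, hm⟩ := exists_split d k
  refine ⟨(MeasurableEquiv.piCongrRight (fun _ : Fin n => e)).trans
    (MeasurableEquiv.arrowProdEquivProdArrow _ _ _), ?_, ?_⟩
  · intro X
    change ((fun i => (e (X i)).1), (fun i => (e (X i)).2)) = _
    simp [he]
  · intro m _
    have h1 := measurePreserving_pi (fun _ : Fin n => Measure.pi m)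
      (fun _ => (m k).prod (Measure.pi fun r : {r // r ≠ k} => m r.1)) (fun _ => hm m)
    exact (measurePreserving_arrowProdEquivProdArrow _ _ _ _ _).comp h1

theorem fac (d : ℕ) (k : Fin d) (m : Fin d → Measure ℝ) [∀ r, IsProbabilityMeasure (m r)]
    (f : ℝ → ℝ) (h : ({r : Fin d // r ≠ k} → ℝ) → ℝ) :
    ∫ x, f (x k) * h (fun r => x r.1) ∂(Measure.pi m) =
      (∫ u, f u ∂(m k)) * ∫ v, h v ∂(Measure.pi fun r : {r : Fin d // r ≠ k} => m r.1) := by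
  obtain ⟨e, he, hm⟩ := exists_split d k
  rw [← integral_prod_mul, ← (hm m).integral_comp e.measurableEmbedding]
  simp [he]

theorem fac_n (d : ℕ) (k : Fin d) (n : ℕ) (m : Fin d → Measure ℝ)
    [∀ r, IsProbabilityMeasure (m r)]
    (f : (Fin n → ℝ) → ℝ) (h : (Fin n → {r : Fin d // r ≠ k} → ℝ) → ℝ) :
    ∫ X : Fin n → Fin d → ℝ, f (fun i => X i k) * h (fun i r => X i r.1)
        ∂(Measure.pi fun _ => Measure.pi m) =
      (∫ u, f u ∂(Measure.pi fun _ => m k)) *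
        ∫ v, h v ∂(Measure.pi fun _ => Measure.pi fun r : {r : Fin d // r ≠ k} => m r.1) := by
  obtain ⟨e, he, hm⟩ := exists_split_n d k n
  rw [← integral_prod_mul, ← (hm m).integral_comp e.measurableEmbedding]
  simp [he]

theorem fac_left (d : ℕ) (k : Fin d) (m : Fin d → Measure ℝ) [∀ r, IsProbabilityMeasure (m r)]
    (f : ℝ → ℝ) : ∫ x, f (x k) ∂(Measure.pi m) = ∫ u, f u ∂(m k) := by
  simpa using fac d k m f (fun _ => 1)

theorem fac_right (d : ℕ) (k : Fin d) (m : Fin d → Measure ℝ) [∀ r, IsProbabilityMeasure (m r)]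
    (h : ({r : Fin d // r ≠ k} → ℝ) → ℝ) : ∫ x : Fin d → ℝ, h (fun r => x r.1) ∂(Measure.pi m) =
      ∫ v, h v ∂(Measure.pi fun r : {r : Fin d // r ≠ k} => m r.1) := by
  simpa using fac d k m (fun _ => 1) h

theorem hsic_zero (d : ℕ) (k : Fin d) (m : Fin d → Measure ℝ) [∀ r, IsProbabilityMeasure (m r)]
    (G : ({r : Fin d // r ≠ k} → ℝ) → ℝ) (lk l : ℝ → ℝ → ℝ)
    (μ : Measure (Fin d → ℝ)) (hμ : μ = Measure.pi m) :
    (∫ x : Fin d → ℝ, (∫ x', lk (x k) (x' k) * l (G fun r => x r.1) (G fun r => x' r.1) ∂μ) ∂μ)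
      + (∫ x, (∫ x', lk (x k) (x' k) ∂μ) ∂μ) *
        (∫ x : Fin d → ℝ, (∫ x' : Fin d → ℝ, l (G fun r => x r.1) (G fun r => x' r.1) ∂μ) ∂μ)
      - 2 * (∫ x : Fin d → ℝ, (∫ y, (∫ z : Fin d → ℝ,
          lk (x k) (y k) * l (G fun r => x r.1) (G fun r => z r.1) ∂μ) ∂μ) ∂μ) = 0 := by
  subst hμ
  have a1 : ∀ x : Fin d → ℝ, ∫ x', lk (x k) (x' k) * l (G fun r => x r.1) (G fun r => x' r.1)
      ∂(Measure.pi m) = _ :=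
    fun x => fac d k m (fun t => lk (x k) t) (fun v => l (G fun r => x r.1) (G v))
  have a2 : ∀ x : Fin d → ℝ, ∫ x', lk (x k) (x' k) ∂(Measure.pi m) = _ :=
    fun x => fac_left d k m (fun t => lk (x k) t)
  have a3 : ∀ x : Fin d → ℝ, ∫ x' : Fin d → ℝ, l (G fun r => x r.1) (G fun r => x' r.1)
      ∂(Measure.pi m) = _ :=
    fun x => fac_right d k m (fun v => l (G fun r => x r.1) (G v))
  simp only [integral_const_mul, integral_mul_const, a1, a2, a3]
  have c1 := fac d k m (fun u => ∫ t, lk u t ∂(m k))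
    (fun w => ∫ v, l (G w) (G v) ∂(Measure.pi fun r : {r : Fin d // r ≠ k} => m r.1))
  have c2 := fac_left d k m (fun u => ∫ t, lk u t ∂(m k))
  have c3 := fac_right d k m
    (fun w => ∫ v, l (G w) (G v) ∂(Measure.pi fun r : {r : Fin d // r ≠ k} => m r.1))
  rw [c1, c2, c3]; ring
theorem int_n (d : ℕ) (k : Fin d) (n : ℕ) (m : Fin d → Measure ℝ)
    [∀ r, IsProbabilityMeasure (m r)]
    (f : (Fin n → ℝ) → ℝ) (h : (Fin n → {r : Fin d // r ≠ k} → ℝ) → ℝ)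
    (hf : Measurable f) (hh : Measurable h) (Bf Bh : ℝ) (hBf : ∀ x, |f x| ≤ Bf)
    (hBh : ∀ x, |h x| ≤ Bh) :
    Integrable (fun X : Fin n → Fin d → ℝ => f (fun i => X i k) * h (fun i r => X i r.1))
        (Measure.pi fun _ => Measure.pi m) := by
  refine Integrable.of_bound (Measurable.aestronglyMeasurable ?_) (Bf * Bh)
    (ae_of_all _ fun X => ?_)
  · exact (hf.comp (by fun_prop)).mul (hh.comp (by fun_prop))
  · rw [Real.norm_eq_abs, abs_mul]
    exact mul_le_mul (hBf _) (hBh _) (abs_nonneg _) ((abs_nonneg _).trans (hBf fun _ => 0))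


theorem lin3 {Ω : Type*} [MeasurableSpace Ω] (P : Measure Ω) (a b c : ℝ) (f g h : Ω → ℝ)
    (hf : Integrable f P) (hg : Integrable g P) (hh : Integrable h P) :
    ∫ x, a * f x + b * g x - c * h x ∂P = a * (∫ x, f x ∂P) + b * (∫ x, g x ∂P)
      - c * ∫ x, h x ∂P := by
  have h1 : Integrable (fun x => a * f x + b * g x) P := (hf.const_mul a).add (hg.const_mul b)
  rw [integral_sub h1 (hh.const_mul c), integral_add (hf.const_mul a) (hg.const_mul b),
    integral_const_mul, integral_const_mul, integral_const_mul]

theorem term_n (d : ℕ) (k : Fin d) (n : ℕ) (m : Fin d → Measure ℝ)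
    [∀ r, IsProbabilityMeasure (m r)]
    (f : (Fin n → ℝ) → ℝ) (h : (Fin n → {r : Fin d // r ≠ k} → ℝ) → ℝ)
    (Φ : (Fin n → Fin d → ℝ) → ℝ)
    (hΦ : ∀ X, Φ X = f (fun i => X i k) * h (fun i r => X i r.1))
    (hf : Measurable f) (hh : Measurable h) (Bf Bh : ℝ) (hBf : ∀ x, |f x| ≤ Bf)
    (hBh : ∀ x, |h x| ≤ Bh) :
    Integrable Φ (Measure.pi fun _ => Measure.pi m) ∧
    ∫ X, Φ X ∂(Measure.pi fun _ => Measure.pi m) = (∫ u, f u ∂(Measure.pi fun _ => m k)) *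
        ∫ v, h v ∂(Measure.pi fun _ => Measure.pi fun r : {r : Fin d // r ≠ k} => m r.1) := by
  have e : Φ = _ := funext hΦ
  rw [e]
  exact ⟨int_n d k n m f h hf hh Bf Bh hBf hBh, fac_n d k n m f h⟩

set_option maxHeartbeats 2000000 in
/-- Proposition 2 (bias of the modified HSIC estimator). Under the product and
independence-hypothesis setting H_{0,k}, with kernels equal to 1 on the diagonal,
HSIC(X_k, Y) = 0 and n·E[H̃SIC_n] converges to
2(E_ω^k − E_{x_k,ω})(E_ω^{−k} − E_{y,ω}) − (E_ω − E_{x_k})(E_ω − E_y) + E_ω(E_ω − 1);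
in particular the modified estimator is asymptotically unbiased with bias O(1/n). -/
theorem modified_hsic_estimator_bias
    (d : ℕ) (k : Fin d)
    (μt : Fin d → Measure ℝ) [∀ r, IsProbabilityMeasure (μt r)]
    (ω : Fin d → ℝ → ℝ) (hωm : ∀ r, Measurable (ω r)) (hω0 : ∀ r t, 0 ≤ ω r t)
    (C : Fin d → ℝ) (hωb : ∀ r t, ω r t ≤ C r)
    (hω1 : ∀ r, ∫ t, ω r t ∂(μt r) = 1)
    -- the original input law μ, whose marginals have density ω_r w.r.t. μ̃_r
    (μ : Measure (Fin d → ℝ))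
    (hμ : μ = Measure.pi fun r => (μt r).withDensity fun t => ENNReal.ofReal (ω r t))
    -- the independence hypothesis H_{0,k}: the output does not depend on the k-th input
    (G : ({r : Fin d // r ≠ k} → ℝ) → ℝ) (hG : Measurable G)
    (F : (Fin d → ℝ) → ℝ) (hFG : ∀ x, F x = G fun r => x r.1)
    (lk l : ℝ → ℝ → ℝ)
    (hlkm : Measurable (Function.uncurry lk)) (hlm : Measurable (Function.uncurry l))
    (Ck Cl : ℝ) (hlkB : ∀ a b, |lk a b| ≤ Ck) (hlB : ∀ a b, |l a b| ≤ Cl)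
    (hlks : ∀ a b, lk a b = lk b a) (hls : ∀ a b, l a b = l b a)
    (hlkd : ∀ u, lk u u = 1) (hld : ∀ y, l y y = 1)
    -- the full importance weight and its marginal over the coordinates other than k
    (W : (Fin d → ℝ) → ℝ) (hW : ∀ x, W x = ∏ r, ω r (x r))
    (Wmk : ({r : Fin d // r ≠ k} → ℝ) → ℝ)
    (hWmk : ∀ v, Wmk v = ∏ r : {r : Fin d // r ≠ k}, ω r.1 (v r))
    -- the modified V-statistic estimator built from the first n sample points
    (V : (n : ℕ) → (Fin n → Fin d → ℝ) → ℝ)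
    (hV : ∀ n X, V n X =
      (1 / (n : ℝ) ^ 2) * ∑ i, ∑ j,
          lk (X i k) (X j k) * l (F (X i)) (F (X j)) * W (X i) * W (X j)
      + (1 / (n : ℝ) ^ 4) * ∑ i, ∑ j, ∑ p, ∑ q,
          lk (X i k) (X j k) * l (F (X p)) (F (X q))
            * W (X i) * W (X j) * W (X p) * W (X q)
      - (2 / (n : ℝ) ^ 3) * ∑ i, ∑ j, ∑ r,
          lk (X i k) (X j k) * l (F (X i)) (F (X r)) * W (X i) * W (X j) * W (X r))
    -- its expectation over an i.i.d. n-sample from μ̃ = ⊗ μ̃_r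
    (E : ℕ → ℝ)
    (hE : ∀ n, E n = ∫ X : Fin n → Fin d → ℝ, V n X
        ∂(Measure.pi fun _ : Fin n => Measure.pi μt))
    -- the HSIC measure of (X_k, Y) under the input law μ
    (HSIC : ℝ)
    (hHSIC : HSIC =
      (∫ x, (∫ x', lk (x k) (x' k) * l (F x) (F x') ∂μ) ∂μ)
      + (∫ x, (∫ x', lk (x k) (x' k) ∂μ) ∂μ) * (∫ x, (∫ x', l (F x) (F x') ∂μ) ∂μ)
      - 2 * (∫ x, (∫ y, (∫ z, lk (x k) (y k) * l (F x) (F z) ∂μ) ∂μ) ∂μ))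
    -- the constants appearing in the limit of the bias
    (Eω Eωk Eωmk Exk Exkω Ey Eyω : ℝ)
    (hEω : Eω = ∫ x, (W x) ^ 2 ∂(Measure.pi μt))
    (hEωk : Eωk = ∫ u, (ω k u) ^ 2 ∂(μt k))
    (hEωmk : Eωmk = ∫ v, (Wmk v) ^ 2
        ∂(Measure.pi fun r : {r : Fin d // r ≠ k} => μt r.1))
    (hExk : Exk = ∫ u, (∫ u', lk u u' * ω k u * ω k u' ∂(μt k)) ∂(μt k))
    (hExkω : Exkω = ∫ u, (∫ u', lk u u' * (ω k u) ^ 2 * ω k u' ∂(μt k)) ∂(μt k))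
    (hEy : Ey = ∫ v, (∫ v', l (G v) (G v') * Wmk v * Wmk v'
        ∂(Measure.pi fun r : {r : Fin d // r ≠ k} => μt r.1))
        ∂(Measure.pi fun r : {r : Fin d // r ≠ k} => μt r.1))
    (hEyω : Eyω = ∫ v, (∫ v', l (G v) (G v') * (Wmk v) ^ 2 * Wmk v'
        ∂(Measure.pi fun r : {r : Fin d // r ≠ k} => μt r.1))
        ∂(Measure.pi fun r : {r : Fin d // r ≠ k} => μt r.1)) :
    HSIC = 0 ∧
      Tendsto (fun n : ℕ => (n : ℝ) * E n) atTop
        (nhds (2 * (Eωk - Exkω) * (Eωmk - Eyω) - (Eω - Exk) * (Eω - Ey)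
          + Eω * (Eω - 1))) := by
  constructor
  · have : ∀ r, IsProbabilityMeasure
        ((μt r).withDensity fun t => ENNReal.ofReal (ω r t)) := by
      intro r
      constructor
      rw [withDensity_apply _ MeasurableSet.univ, Measure.restrict_univ,
        ← ofReal_integral_eq_lintegral_ofReal _ (ae_of_all _ (hω0 r)), hω1, ENNReal.ofReal_one]
      by_contra hcon
      have := hω1 r
      rw [integral_undef hcon] at this
      exact zero_ne_one this
    rw [hHSIC]
    simp only [hFG]
    exact hsic_zero d k _ G lk l μ hμ
  -- the second part
  have hWs : ∀ x : Fin d → ℝ, W x = ω k (x k) * Wmk (fun r => x r.1) := by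
    intro x
    rw [hW, hWmk, Fintype.prod_eq_mul_prod_subtype_ne _ k]
  set ν := Measure.pi fun r : {r : Fin d // r ≠ k} => μt r.1 with hν
  set L : ({r : Fin d // r ≠ k} → ℝ) → ({r : Fin d // r ≠ k} → ℝ) → ℝ :=
    fun v v' => l (G v) (G v') with hL
  have hLm : Measurable (Function.uncurry L) :=
    hlm.comp (f := fun p : ({r : Fin d // r ≠ k} → ℝ) × ({r : Fin d // r ≠ k} → ℝ) =>
      (G p.1, G p.2)) (by fun_prop)
  have hLB : ∀ a b, |L a b| ≤ Cl := fun a b => hlB _ _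
  have hLs : ∀ a b, L a b = L b a := fun a b => hls _ _
  have hLd : ∀ a, L a a = 1 := fun a => hld _
  have hgm : Measurable Wmk := by
    have : Wmk = fun v => ∏ r : {r : Fin d // r ≠ k}, ω r.1 (v r) := funext hWmk
    rw [this]
    exact Finset.measurable_prod _ fun r _ => (hωm r.1).comp (measurable_pi_apply r)
  have hfB : ∀ a, |ω k a| ≤ C k := fun a => by rw [abs_of_nonneg (hω0 k a)]; exact hωb k a
  have hgB : ∀ a, |Wmk a| ≤ ∏ r : {r : Fin d // r ≠ k}, C r.1 := by
    intro a
    rw [hWmk, abs_of_nonneg (Finset.prod_nonneg fun r _ => hω0 _ _)]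
    exact Finset.prod_le_prod (fun r _ => hω0 _ _) fun r _ => hωb _ _
  set D := ∏ r : {r : Fin d // r ≠ k}, C r.1
  have hg1 : ∫ v, Wmk v ∂ν = 1 := by
    simp only [hWmk, hν]
    rw [integral_fintype_prod_eq_prod (fun (r : {r : Fin d // r ≠ k}) t => ω r.1 t)]
    simp [hω1]
  have hf1 := hω1 k
  have hfm := hωm k
  have hEE : Eω = Eωk * Eωmk := by
    rw [hEω, hEωk, hEωmk, ← fac d k μt (fun u => ω k u ^ 2) (fun v => Wmk v ^ 2)]
    simp only [hWs, mul_pow]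
  -- abbreviations
  have aQ : ∀ n i j, i ≠ j → QQ (μt k) lk (ω k) n i j = Exk := fun n i j h => by
    rw [hExk]; exact QQ_ne _ _ _ Ck (C k) hlkm hfm hlkB hfB n i j h
  have bQ : ∀ n i j, i ≠ j → QQ ν L Wmk n i j = Ey := fun n i j h => by
    rw [hEy]; exact QQ_ne _ _ _ Cl D hLm hgm hLB hgB n i j h
  have aQd : ∀ n i, QQ (μt k) lk (ω k) n i i = Eωk := fun n i => by
    rw [hEωk]; exact QQ_eq _ _ _ hfm hlkd n i
  have bQd : ∀ n i, QQ ν L Wmk n i i = Eωmk := fun n i => by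
    rw [hEωmk]; exact QQ_eq _ _ _ hgm hLd n i
  have aN : ∀ n i j r, i ≠ r → j ≠ r → NN (μt k) lk (ω k) n i j r = QQ (μt k) lk (ω k) n i j :=
    NN_disj _ _ _ hlkm hfm hf1
  have bN : ∀ n i j r, i ≠ r → j ≠ r → NN ν L Wmk n i j r = QQ ν L Wmk n i j :=
    NN_disj _ _ _ hLm hgm hg1
  have aN1 : ∀ n i j, i ≠ j → NN (μt k) lk (ω k) n i j i = Exkω := fun n i j h => by
    rw [hExkω]; exact NN_c _ _ _ Ck (C k) hlkm hfm hlkB hfB n i j h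
  have bN1 : ∀ n i j, i ≠ j → NN ν L Wmk n i j i = Eyω := fun n i j h => by
    rw [hEyω]; exact NN_c _ _ _ Cl D hLm hgm hLB hgB n i j h
  have aN2 : ∀ n i j, i ≠ j → NN (μt k) lk (ω k) n i j j = Exkω := fun n i j h => by
    rw [NN_swap _ _ _ hlks]; exact aN1 n j i h.symm
  have bN2 : ∀ n i j, i ≠ j → NN ν L Wmk n i j j = Eyω := fun n i j h => by
    rw [NN_swap _ _ _ hLs]; exact bN1 n j i h.symm
  have aM0 : ∀ n i j p q, i ≠ p → i ≠ q → j ≠ p → j ≠ q → p ≠ q →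
      MM (μt k) lk (ω k) n i j p q = QQ (μt k) lk (ω k) n i j := fun n i j p q h1 h2 h3 h4 h5 => by
    rw [MM_disj _ _ _ hlkm hfm n i j p q h1 h2 h3 h4, gg_ne _ _ hfm hf1 n p q h5, mul_one]
  have bM0 : ∀ n i j p q, i ≠ p → i ≠ q → j ≠ p → j ≠ q → p ≠ q →
      MM ν L Wmk n i j p q = QQ ν L Wmk n i j := fun n i j p q h1 h2 h3 h4 h5 => by
    rw [MM_disj _ _ _ hLm hgm n i j p q h1 h2 h3 h4, gg_ne _ _ hgm hg1 n p q h5, mul_one]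
  have aMd : ∀ n i j p, i ≠ p → j ≠ p →
      MM (μt k) lk (ω k) n i j p p = QQ (μt k) lk (ω k) n i j * Eωk := fun n i j p h1 h3 => by
    rw [MM_disj _ _ _ hlkm hfm n i j p p h1 h1 h3 h3, gg_eq _ _ hfm n p, hEωk]
  have bMd : ∀ n i j p, i ≠ p → j ≠ p →
      MM ν L Wmk n i j p p = QQ ν L Wmk n i j * Eωmk := fun n i j p h1 h3 => by
    rw [MM_disj _ _ _ hLm hgm n i j p p h1 h1 h3 h3, gg_eq _ _ hgm n p, hEωmk]
  have aM1 : ∀ n i j q, i ≠ j → i ≠ q → j ≠ q → MM (μt k) lk (ω k) n i j i q = Exkω :=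
    fun n i j q h1 h2 h3 => by
      rw [MM_c _ _ _ hlkm hfm hf1 n i j q h2 h3, aN1 n i j h1]
  have aM2 : ∀ n i j q, i ≠ j → i ≠ q → j ≠ q → MM (μt k) lk (ω k) n i j q i = Exkω :=
    fun n i j q h1 h2 h3 => by rw [MM_swap2, aM1 n i j q h1 h2 h3]
  have aM3 : ∀ n i j q, i ≠ j → i ≠ q → j ≠ q → MM (μt k) lk (ω k) n i j j q = Exkω :=
    fun n i j q h1 h2 h3 => by rw [MM_swap1 _ _ _ hlks, aM1 n j i q h1.symm h3 h2]
  have aM4 : ∀ n i j q, i ≠ j → i ≠ q → j ≠ q → MM (μt k) lk (ω k) n i j q j = Exkω :=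
    fun n i j q h1 h2 h3 => by rw [MM_swap2, aM3 n i j q h1 h2 h3]
  have bM1 : ∀ n i j q, i ≠ j → i ≠ q → j ≠ q → MM ν L Wmk n i j i q = Eyω :=
    fun n i j q h1 h2 h3 => by
      rw [MM_c _ _ _ hLm hgm hg1 n i j q h2 h3, bN1 n i j h1]
  have bM2 : ∀ n i j q, i ≠ j → i ≠ q → j ≠ q → MM ν L Wmk n i j q i = Eyω :=
    fun n i j q h1 h2 h3 => by rw [MM_swap2, bM1 n i j q h1 h2 h3]
  have bM3 : ∀ n i j q, i ≠ j → i ≠ q → j ≠ q → MM ν L Wmk n i j j q = Eyω :=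
    fun n i j q h1 h2 h3 => by rw [MM_swap1 _ _ _ hLs, bM1 n j i q h1.symm h3 h2]
  have bM4 : ∀ n i j q, i ≠ j → i ≠ q → j ≠ q → MM ν L Wmk n i j q j = Eyω :=
    fun n i j q h1 h2 h3 => by rw [MM_swap2, bM3 n i j q h1 h2 h3]
  -- limits
  have l2 := lim2 (fun n i j => QQ (μt k) lk (ω k) n i j * QQ ν L Wmk n i j) (Exk * Ey)
    (Eωk * Eωmk) (fun n i j h => by rw [aQ n i j h, bQ n i j h]) (fun n i => by rw [aQd, bQd])
  have l3 := lim3 (fun n i j r => NN (μt k) lk (ω k) n i j r * NN ν L Wmk n i r j)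
    ((Ck * C k * C k * C k) * (Cl * D * D * D)) (Exk * Ey)
    (Eωk * Eyω) (Exkω * Eωmk) (Exkω * Eyω)
    (fun n i j r => by
      rw [abs_mul]
      have h1 : |NN (μt k) lk (ω k) n i j r| ≤ Ck * C k * C k * C k :=
        bdd_int _ _ _ fun s => b3 lk (ω k) Ck (C k) hlkB hfB _ _ _
      have h2 : |NN ν L Wmk n i r j| ≤ Cl * D * D * D :=
        bdd_int _ _ _ fun s => b3 L Wmk Cl D hLB hgB _ _ _
      exact mul_le_mul h1 h2 (abs_nonneg _) ((abs_nonneg _).trans h1))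
    (fun n i j r h1 h2 h3 => by
      rw [aN n i j r h2 h3, bN n i r j h1 h3.symm, aQ n i j h1, bQ n i r h2])
    (fun n i r h => by rw [aN n i i r h h, aQd, bN1 n i r h])
    (fun n i j h => by rw [aN1 n i j h, bN n i i j h h, bQd])
    (fun n i j h => by rw [aN2 n i j h, bN2 n i j h])
  have l4 := lim4 (fun n i j p q => MM (μt k) lk (ω k) n i j p q * MM ν L Wmk n p q i j)
    ((Ck * C k * C k * C k * C k) * (Cl * D * D * D * D)) (Exk * Ey)
    (Eωk * (Ey * Eωmk)) ((Exk * Eωk) * Eωmk) (Exkω * Eyω) (Exkω * Eyω) (Exkω * Eyω) (Exkω * Eyω)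
    (fun n i j p q => by
      rw [abs_mul]
      have h1 : |MM (μt k) lk (ω k) n i j p q| ≤ Ck * C k * C k * C k * C k :=
        bdd_int _ _ _ fun s => b4 lk (ω k) Ck (C k) hlkB hfB _ _ _ _
      have h2 : |MM ν L Wmk n p q i j| ≤ Cl * D * D * D * D :=
        bdd_int _ _ _ fun s => b4 L Wmk Cl D hLB hgB _ _ _ _
      exact mul_le_mul h1 h2 (abs_nonneg _) ((abs_nonneg _).trans h1))
    (fun n i j p q h1 h2 h3 h4 h5 h6 => by
      rw [aM0 n i j p q h2 h3 h4 h5 h6, bM0 n p q i j h2.symm h4.symm h3.symm h5.symm h1,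
        aQ n i j h1, bQ n p q h6])
    (fun n i p q h1 h2 h3 => by
      rw [aM0 n i i p q h1 h2 h1 h2 h3, bMd n p q i h1.symm h2.symm, aQd, bQ n p q h3])
    (fun n i j p h1 h2 h3 => by
      rw [aMd n i j p h2 h3, bM0 n p p i j h2.symm h3.symm h2.symm h3.symm h1, bQd, aQ n i j h1])
    (fun n i j q h1 h2 h3 => by
      rw [aM1 n i j q h1 h2 h3, bM1 n i q j h2 h1 h3.symm])
    (fun n i j p h1 h2 h3 => by
      rw [aM2 n i j p h1 h2 h3, bM3 n p i j h2.symm h3.symm h1])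
    (fun n i j q h1 h2 h3 => by
      rw [aM3 n i j q h1 h2 h3, bM2 n j q i h3 h1.symm h2.symm])
    (fun n i j p h1 h2 h3 => by
      rw [aM4 n i j p h1 h2 h3, bM4 n p j i h3.symm h2.symm h1.symm])
  have hlim := (l2.add l4).sub (l3.const_mul 2)
  convert hlim using 1
  · funext n
    have mA := fun i j : Fin n => mK lk (ω k) hlkm hfm n i j
    have mB := fun i j : Fin n => mK L Wmk hLm hgm n i j
    have i1 : ∀ i j : Fin n, Integrable (fun X : Fin n → Fin d → ℝ =>
        lk (X i k) (X j k) * l (F (X i)) (F (X j)) * W (X i) * W (X j))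
          (Measure.pi fun _ => Measure.pi μt) ∧
        ∫ X : Fin n → Fin d → ℝ, lk (X i k) (X j k) * l (F (X i)) (F (X j)) * W (X i) * W (X j)
          ∂(Measure.pi fun _ => Measure.pi μt)
          = QQ (μt k) lk (ω k) n i j * QQ ν L Wmk n i j := by
      intro i j
      unfold QQ
      refine term_n d k n μt
          (fun s : Fin n → ℝ => lk (s i) (s j) * ω k (s i) * ω k (s j))
          (fun s : Fin n → {r : Fin d // r ≠ k} → ℝ =>
            L (s i) (s j) * Wmk (s i) * Wmk (s j)) _ ?_ ?_ ?_ _ _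
          (fun s => b2 lk (ω k) Ck (C k) hlkB hfB _ _)
          (fun s => b2 L Wmk Cl D hLB hgB _ _)
      · intro X; simp only [hWs, hFG, hL]; ring
      · have := mA i j; fun_prop
      · have := mB i j; fun_prop
    have i2 : ∀ i j p q : Fin n, Integrable (fun X : Fin n → Fin d → ℝ =>
        lk (X i k) (X j k) * l (F (X p)) (F (X q)) * W (X i) * W (X j) * W (X p) * W (X q))
          (Measure.pi fun _ => Measure.pi μt) ∧
        ∫ X : Fin n → Fin d → ℝ,
          lk (X i k) (X j k) * l (F (X p)) (F (X q)) * W (X i) * W (X j) * W (X p) * W (X q)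
          ∂(Measure.pi fun _ => Measure.pi μt)
          = MM (μt k) lk (ω k) n i j p q * MM ν L Wmk n p q i j := by
      intro i j p q
      unfold MM
      refine term_n d k n μt
          (fun s : Fin n → ℝ => lk (s i) (s j) * ω k (s i) * ω k (s j) * ω k (s p) * ω k (s q))
          (fun s : Fin n → {r : Fin d // r ≠ k} → ℝ =>
            L (s p) (s q) * Wmk (s p) * Wmk (s q) * Wmk (s i) * Wmk (s j)) _ ?_ ?_ ?_ _ _
          (fun s => b4 lk (ω k) Ck (C k) hlkB hfB _ _ _ _)
          (fun s => b4 L Wmk Cl D hLB hgB _ _ _ _)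
      · intro X; simp only [hWs, hFG, hL]; ring
      · have := mA i j; fun_prop
      · have := mB p q; fun_prop
    have i3 : ∀ i j r : Fin n, Integrable (fun X : Fin n → Fin d → ℝ =>
        lk (X i k) (X j k) * l (F (X i)) (F (X r)) * W (X i) * W (X j) * W (X r))
          (Measure.pi fun _ => Measure.pi μt) ∧
        ∫ X : Fin n → Fin d → ℝ,
          lk (X i k) (X j k) * l (F (X i)) (F (X r)) * W (X i) * W (X j) * W (X r)
          ∂(Measure.pi fun _ => Measure.pi μt)
          = NN (μt k) lk (ω k) n i j r * NN ν L Wmk n i r j := by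
      intro i j r
      unfold NN
      refine term_n d k n μt
          (fun s : Fin n → ℝ => lk (s i) (s j) * ω k (s i) * ω k (s j) * ω k (s r))
          (fun s : Fin n → {r : Fin d // r ≠ k} → ℝ =>
            L (s i) (s r) * Wmk (s i) * Wmk (s r) * Wmk (s j)) _ ?_ ?_ ?_ _ _
          (fun s => b3 lk (ω k) Ck (C k) hlkB hfB _ _ _)
          (fun s => b3 L Wmk Cl D hLB hgB _ _ _)
      · intro X; simp only [hWs, hFG, hL]; ring
      · have := mA i j; fun_prop
      · have := mB i r; fun_prop
    have s1 : Integrable (fun X : Fin n → Fin d → ℝ => ∑ i, ∑ j,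
          lk (X i k) (X j k) * l (F (X i)) (F (X j)) * W (X i) * W (X j))
          (Measure.pi fun _ => Measure.pi μt) :=
      integrable_finsetSum _ fun i _ => integrable_finsetSum _ fun j _ => (i1 i j).1
    have s2 : Integrable (fun X : Fin n → Fin d → ℝ => ∑ i, ∑ j, ∑ p, ∑ q,
          lk (X i k) (X j k) * l (F (X p)) (F (X q))
            * W (X i) * W (X j) * W (X p) * W (X q))
          (Measure.pi fun _ => Measure.pi μt) :=
      integrable_finsetSum _ fun i _ => integrable_finsetSum _ fun j _ =>
        integrable_finsetSum _ fun p _ => integrable_finsetSum _ fun q _ => (i2 i j p q).1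
    have s3 : Integrable (fun X : Fin n → Fin d → ℝ => ∑ i, ∑ j, ∑ r,
          lk (X i k) (X j k) * l (F (X i)) (F (X r)) * W (X i) * W (X j) * W (X r))
          (Measure.pi fun _ => Measure.pi μt) :=
      integrable_finsetSum _ fun i _ => integrable_finsetSum _ fun j _ =>
        integrable_finsetSum _ fun p _ => (i3 i j p).1
    have hEn : E n = (1 / (n : ℝ) ^ 2) * (∑ i, ∑ j,
          QQ (μt k) lk (ω k) n i j * QQ ν L Wmk n i j)
        + (1 / (n : ℝ) ^ 4) * (∑ i, ∑ j, ∑ p, ∑ q,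
          MM (μt k) lk (ω k) n i j p q * MM ν L Wmk n p q i j)
        - (2 / (n : ℝ) ^ 3) * (∑ i, ∑ j, ∑ r,
          NN (μt k) lk (ω k) n i j r * NN ν L Wmk n i r j) := by
      rw [hE]
      simp only [hV]
      rw [lin3 _ _ _ _ _ _ _ s1 s2 s3]
      congr 1
      · congr 1
        · congr 1
          rw [integral_finsetSum _ fun i _ => integrable_finsetSum _ fun j _ => (i1 i j).1]
          refine Finset.sum_congr rfl fun i _ => ?_
          rw [integral_finsetSum _ fun j _ => (i1 i j).1]
          exact Finset.sum_congr rfl fun j _ => (i1 i j).2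
        · congr 1
          rw [integral_finsetSum _ fun i _ => integrable_finsetSum _ fun j _ =>
            integrable_finsetSum _ fun p _ => integrable_finsetSum _ fun q _ => (i2 i j p q).1]
          refine Finset.sum_congr rfl fun i _ => ?_
          rw [integral_finsetSum _ fun j _ =>
            integrable_finsetSum _ fun p _ => integrable_finsetSum _ fun q _ => (i2 i j p q).1]
          refine Finset.sum_congr rfl fun j _ => ?_
          rw [integral_finsetSum _ fun p _ => integrable_finsetSum _ fun q _ => (i2 i j p q).1]
          refine Finset.sum_congr rfl fun p _ => ?_
          rw [integral_finsetSum _ fun q _ => (i2 i j p q).1]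
          exact Finset.sum_congr rfl fun q _ => (i2 i j p q).2
      · congr 1
        rw [integral_finsetSum _ fun i _ => integrable_finsetSum _ fun j _ =>
            integrable_finsetSum _ fun p _ => (i3 i j p).1]
        refine Finset.sum_congr rfl fun i _ => ?_
        rw [integral_finsetSum _ fun j _ =>
            integrable_finsetSum _ fun p _ => (i3 i j p).1]
        refine Finset.sum_congr rfl fun j _ => ?_
        rw [integral_finsetSum _ fun p _ => (i3 i j p).1]
        exact Finset.sum_congr rfl fun p _ => (i3 i j p).2
    rw [hEn]; ring
  · congr 1
    rw [hEE]; ring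
end

section
/- (Proposition 3, variance of the modified HSIC estimator) Assume the product and independence-hypothesis setting (H_{0,k}) and that l_k(u,u) = 1 and l(y,y) = 1 for all u, y. Let X̃^{(1)}, X̃^{(2)}, … be i.i.d. with law μ̃ and let H̃SIC_n be the modified V-statistic estimator built from the first n points. Then n² · Var(H̃SIC_n) converges, as n → ∞, to 72 ζ₂, where ζ₂ = ∬ ( ∬ h̃(z₁, z₂, z₃, z₄) dμ̃(z₃) dμ̃(z₄) )² dμ̃(z₁) dμ̃(z₂) and h̃ is the symmetrized weighted kernel; in particular Var(H̃SIC_n) = (72(n−4)(n−5)/(n(n−1)(n−2)(n−3))) ζ₂ + O(1/n³) converges to 0 at rate O(1/n²). -/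
open MeasureTheory Filter
open scoped BigOperators

namespace HsicAux

set_option linter.unusedSectionVars false

variable {Ω : Type*} [MeasurableSpace Ω]

/-- bounded measurable functions -/
def Nice (f : Ω → ℝ) : Prop := Measurable f ∧ ∃ C, ∀ x, |f x| ≤ C

theorem Nice.integrable {f : Ω → ℝ} (h : Nice f) (μ : Measure Ω) [IsFiniteMeasure μ] :
    Integrable f μ := by
  obtain ⟨hm, C, hC⟩ := h
  exact Integrable.of_bound hm.aestronglyMeasurable C (Eventually.of_forall hC)

theorem Nice.mul {f g : Ω → ℝ} (hf : Nice f) (hg : Nice g) : Nice (fun x => f x * g x) := by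
  obtain ⟨hm, C, hC⟩ := hf
  obtain ⟨hm', C', hC'⟩ := hg
  refine ⟨hm.mul hm', C * C', fun x => ?_⟩
  rw [abs_mul]
  exact mul_le_mul (hC x) (hC' x) (abs_nonneg _) ((abs_nonneg _).trans (hC x))

theorem Nice.add {f g : Ω → ℝ} (hf : Nice f) (hg : Nice g) : Nice (fun x => f x + g x) := by
  obtain ⟨hm, C, hC⟩ := hf
  obtain ⟨hm', C', hC'⟩ := hg
  exact ⟨hm.add hm', C + C', fun x => (abs_add_le _ _).trans (add_le_add (hC x) (hC' x))⟩

theorem Nice.sub {f g : Ω → ℝ} (hf : Nice f) (hg : Nice g) : Nice (fun x => f x - g x) := by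
  obtain ⟨hm, C, hC⟩ := hf
  obtain ⟨hm', C', hC'⟩ := hg
  exact ⟨hm.sub hm', C + C', fun x => (abs_sub _ _).trans (add_le_add (hC x) (hC' x))⟩

theorem Nice.const (c : ℝ) : Nice (fun _ : Ω => c) := ⟨measurable_const, |c|, fun _ => le_rfl⟩

theorem Nice.comp {Ω' : Type*} [MeasurableSpace Ω'] {f : Ω → ℝ} (hf : Nice f) {g : Ω' → Ω}
    (hg : Measurable g) : Nice (fun x => f (g x)) :=
  ⟨hf.1.comp hg, hf.2.imp fun _ h _ => h _⟩

theorem Nice.sum {ι : Type*} (s : Finset ι) {f : ι → Ω → ℝ} (hf : ∀ i, Nice (f i)) :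
    Nice (fun x => ∑ i ∈ s, f i x) := by
  choose hm C hC using hf
  exact ⟨Finset.measurable_fun_sum s fun i _ => hm i, ∑ i ∈ s, C i, fun x =>
    (Finset.abs_sum_le_sum_abs _ _).trans (Finset.sum_le_sum fun i _ => hC i x)⟩

theorem Nice.int {Ω' : Type*} [MeasurableSpace Ω'] {f : Ω × Ω' → ℝ} (hf : Nice f)
    (μ : Measure Ω') [IsProbabilityMeasure μ] : Nice (fun x => ∫ y, f (x, y) ∂μ) := by
  obtain ⟨hm, C, hC⟩ := hf
  refine ⟨(hm.stronglyMeasurable.integral_prod_right' (ν := μ)).measurable, C, fun x => ?_⟩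
  have := norm_integral_le_of_norm_le_const (μ := μ) (f := fun y => f (x, y)) (C := C)
    (Eventually.of_forall fun y => hC (x, y))
  simpa using this

theorem mp_integral {Ω' : Type*} [MeasurableSpace Ω'] {μ : Measure Ω} {ν : Measure Ω'}
    {g : Ω → Ω'} (hg : MeasurePreserving g μ ν) {f : Ω' → ℝ} (hf : Nice f) :
    ∫ y, f y ∂ν = ∫ x, f (g x) ∂μ := by
  rw [← hg.map_eq, integral_map hg.measurable.aemeasurable hf.1.aestronglyMeasurable]

open Classical in
theorem resample {ι : Type*} [Fintype ι] (μ : ι → Measure Ω) [∀ i, IsProbabilityMeasure (μ i)]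
    (S : Set ι) :
    MeasurePreserving (fun p : (ι → Ω) × (ι → Ω) => fun i => if i ∈ S then p.1 i else p.2 i)
      ((Measure.pi μ).prod (Measure.pi μ)) (Measure.pi μ) := by
  have hm : Measurable
      (fun p : (ι → Ω) × (ι → Ω) => fun i => if i ∈ S then p.1 i else p.2 i) := by
    refine measurable_pi_lambda _ fun i => ?_
    by_cases hi : i ∈ S <;> simp only [hi, if_true, if_false] <;> fun_prop
  refine ⟨hm, ?_⟩
  symm
  refine Measure.pi_eq fun s hs => ?_
  rw [Measure.map_apply hm (MeasurableSet.univ_pi hs)]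
  have : (fun p : (ι → Ω) × (ι → Ω) => fun i => if i ∈ S then p.1 i else p.2 i) ⁻¹'
      (Set.univ.pi s) = (Set.univ.pi fun i => if i ∈ S then s i else Set.univ) ×ˢ
        (Set.univ.pi fun i => if i ∈ S then Set.univ else s i) := by
    ext p
    simp only [Set.mem_preimage, Set.mem_univ_pi, Set.mem_prod]
    rw [← forall_and]
    refine forall_congr' fun i => ?_
    by_cases hi : i ∈ S <;> simp [hi]
  rw [this, Measure.prod_prod, Measure.pi_pi, Measure.pi_pi, ← Finset.prod_mul_distrib]
  refine Finset.prod_congr rfl fun i _ => ?_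
  by_cases hi : i ∈ S <;> simp [hi]

open Classical in
theorem resample_integral {ι : Type*} [Fintype ι] (μ : ι → Measure Ω)
    [∀ i, IsProbabilityMeasure (μ i)] (S : Set ι) {f : (ι → Ω) → ℝ} (hf : Nice f) :
    ∫ x, f x ∂(Measure.pi μ) =
      ∫ x, ∫ y, f (fun i => if i ∈ S then x i else y i) ∂(Measure.pi μ) ∂(Measure.pi μ) := by
  rw [mp_integral (resample μ S) hf]
  exact integral_prod _ ((hf.comp (resample μ S).measurable).integrable _)

theorem marg {ι κ : Type*} [Fintype ι] [Fintype κ] (μ : Measure Ω) [IsProbabilityMeasure μ]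
    (t : κ → ι) (ht : Function.Injective t) :
    MeasurePreserving (fun (X : ι → Ω) (i : κ) => X (t i)) (Measure.pi fun _ => μ)
      (Measure.pi fun _ => μ) := by
  classical
  have hm : Measurable (fun (X : ι → Ω) (i : κ) => X (t i)) := by fun_prop
  refine ⟨hm, ?_⟩
  symm
  refine Measure.pi_eq fun s hs => ?_
  rw [Measure.map_apply hm (MeasurableSet.univ_pi hs)]
  have : (fun (X : ι → Ω) (i : κ) => X (t i)) ⁻¹' (Set.univ.pi s) =
      Set.univ.pi fun j => ⋂ i, ⋂ (_ : t i = j), s i := by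
    ext X
    simp only [Set.mem_preimage, Set.mem_univ_pi, Set.mem_iInter]
    constructor
    · rintro h j i rfl; exact h i
    · intro h i; exact h _ i rfl
  rw [this, Measure.pi_pi]
  rw [← Finset.prod_subset (Finset.subset_univ (Finset.univ.image t))]
  · rw [Finset.prod_image fun a _ b _ h => ht h]
    refine Finset.prod_congr rfl fun i _ => ?_
    congr 1
    ext x
    simp [ht.eq_iff]
  · intro j _ hj
    have : (⋂ i, ⋂ (_ : t i = j), s i) = Set.univ := by
      ext x
      simp only [Set.mem_iInter, Set.mem_univ, iff_true]
      intro i hi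
      exact absurd (Finset.mem_image_of_mem t (Finset.mem_univ i)) (hi ▸ hj)
    rw [this]; simp

theorem pi_succ (μ : Measure Ω) [IsProbabilityMeasure μ] (n : ℕ) {f : (Fin (n+1) → Ω) → ℝ}
    (hf : Nice f) : ∫ z, f z ∂(Measure.pi fun _ => μ) =
      ∫ x, ∫ y : Fin n → Ω, f (Matrix.vecCons x y) ∂(Measure.pi fun _ => μ) ∂μ := by
  have h := (measurePreserving_piFinSuccAbove (fun _ : Fin (n+1) => μ) 0).symm
  rw [mp_integral h hf]
  rw [integral_prod _ ((hf.comp h.measurable).integrable _)]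
  simp [MeasurableEquiv.piFinSuccAbove, Fin.insertNthEquiv, Matrix.vecCons]

theorem meas_vecCons (n : ℕ) : Measurable (fun p : Ω × (Fin n → Ω) =>
    (Matrix.vecCons p.1 p.2 : Fin (n+1) → Ω)) := by
  refine measurable_pi_lambda _ fun i => ?_
  refine Fin.cases ?_ (fun j => ?_) i
  · simpa using measurable_fst
  · simp only [Matrix.cons_val_succ]; fun_prop

theorem pi_four (μ : Measure Ω) [IsProbabilityMeasure μ] {f : (Fin 4 → Ω) → ℝ}
    (hf : Nice f) : ∫ z, f z ∂(Measure.pi fun _ => μ) =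
      ∫ a, ∫ b, ∫ c, ∫ e, f ![a, b, c, e] ∂μ ∂μ ∂μ ∂μ := by
  have hv (n : ℕ) (x : Ω) : Measurable (fun y : Fin n → Ω => (Matrix.vecCons x y : Fin (n+1) → Ω)) :=
    (meas_vecCons n).comp (measurable_const.prodMk measurable_id)
  rw [pi_succ μ 3 hf]
  congr 1; ext a
  rw [pi_succ μ 2 (hf.comp (hv 3 a))]
  congr 1; ext b
  rw [pi_succ μ 1 ((hf.comp (hv 3 a)).comp (hv 2 b))]
  congr 1; ext c
  rw [pi_succ μ 0 (((hf.comp (hv 3 a)).comp (hv 2 b)).comp (hv 1 c))]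
  congr 1; ext e
  rw [Measure.pi_of_empty, integral_dirac]
  congr

section abs
variable (μ : Measure Ω) [IsProbabilityMeasure μ] (h : (Fin 4 → Ω) → ℝ)

/-- second projection -/
noncomputable def h2 (p : Ω × Ω) : ℝ :=
  ∫ z : Fin 4 → Ω, h ![p.1, p.2, z 2, z 3] ∂(Measure.pi fun _ => μ)

theorem h2_nice (hn : Nice h) : Nice (h2 μ h) := by
  unfold h2
  refine Nice.int (f := fun q : (Ω × Ω) × (Fin 4 → Ω) => h ![q.1.1, q.1.2, q.2 2, q.2 3]) ?_ _
  refine hn.comp ?_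
  refine measurable_pi_lambda _ fun i => ?_
  fin_cases i <;> simp <;> fun_prop

theorem pair_int {ι : Type*} [Fintype ι] {f : Ω × Ω → ℝ} (hf : Nice f) (i j : ι) (hij : i ≠ j) :
    ∫ X : ι → Ω, f (X i, X j) ∂(Measure.pi fun _ => μ) = ∫ x, ∫ y, f (x, y) ∂μ ∂μ := by
  classical
  have h1 : Nice (fun X : ι → Ω => f (X i, X j)) := hf.comp (by fun_prop)
  rw [resample_integral (fun _ => μ) {i} h1]
  simp only [Set.mem_singleton_iff, if_true, hij.symm, if_false]
  have hh (x : Ω) : ∫ X : ι → Ω, f (x, X j) ∂(Measure.pi fun _ => μ) = ∫ y, f (x, y) ∂μ :=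
    (mp_integral (measurePreserving_eval (fun _ : ι => μ) j)
      (hf.comp (measurable_const.prodMk measurable_id))).symm
  simp only [hh]
  exact (mp_integral (measurePreserving_eval (fun _ : ι => μ) i) (hf.int μ)).symm

variable {n : ℕ}

/-- expectation of a product -/
noncomputable def EP (s t : Fin 4 → Fin n) : ℝ :=
  ∫ X : Fin n → Ω, h (fun i => X (s i)) * h (fun i => X (t i)) ∂(Measure.pi fun _ => μ)

/-- expectation -/
noncomputable def ES (s : Fin 4 → Fin n) : ℝ :=
  ∫ X : Fin n → Ω, h (fun i => X (s i)) ∂(Measure.pi fun _ => μ)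

variable {h}

theorem nice_comp (hn : Nice h) (s : Fin 4 → Fin n) :
    Nice (fun X : Fin n → Ω => h (fun i => X (s i))) := hn.comp (by fun_prop)

open Classical in
theorem cond (hn : Nice h) (t : Fin 4 → Fin n) (S : Set (Fin n)) {g : (Fin n → Ω) → ℝ}
    (hg : Nice g) (hgS : ∀ X Y : Fin n → Ω, (∀ i ∈ S, X i = Y i) → g X = g Y) :
    ∫ X : Fin n → Ω, g X * h (fun i => X (t i)) ∂(Measure.pi fun _ => μ) =
    ∫ X : Fin n → Ω, g X * ∫ Y : Fin n → Ω, h (fun i => if t i ∈ S then X (t i) else Y (t i))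
      ∂(Measure.pi fun _ => μ) ∂(Measure.pi fun _ => μ) := by
  rw [resample_integral (fun _ => μ) S (hg.mul (nice_comp hn t))]
  congr 1; ext X
  rw [← integral_const_mul]
  congr 1; ext Y
  rw [hgS (fun i => if i ∈ S then X i else Y i) X]
  intro i hi; simp [hi]

theorem cov_disj (hn : Nice h) (s t : Fin 4 → Fin n) (hd : ∀ a c, s a ≠ t c) :
    EP μ h s t = ES μ h s * ES μ h t := by
  unfold EP
  rw [cond μ hn t (Set.range s) (nice_comp hn s)]
  · have : ∀ i, t i ∉ Set.range s := by rintro i ⟨a, ha⟩; exact hd a i ha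
    simp only [this, if_false]
    rw [integral_mul_const]; rfl
  · intro X Y hXY
    congr 1; ext i; exact hXY _ ⟨i, rfl⟩

theorem EP_comm (s t : Fin 4 → Fin n) : EP μ h s t = EP μ h t s := by
  unfold EP; simp only [mul_comm]

theorem inner_one (hn : Nice h)
    (hdeg : ∀ c x, ∫ z, h (Function.update z c x) ∂(Measure.pi fun _ => μ) = 0)
    (t : Fin 4 → Fin n) (ht : Function.Injective t) (c : Fin 4) (x : Ω) :
    ∫ Y : Fin n → Ω, h (Function.update (fun i => Y (t i)) c x) ∂(Measure.pi fun _ => μ) = 0 := by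
  rw [← hdeg c x, mp_integral (marg μ t ht) (f := fun z => h (Function.update z c x))]
  refine hn.comp ?_
  fun_prop

open Classical in
theorem ES_zero (hn : Nice h)
    (hdeg : ∀ c x, ∫ z, h (Function.update z c x) ∂(Measure.pi fun _ => μ) = 0)
    (t : Fin 4 → Fin n) (ht : Function.Injective t) : ES μ h t = 0 := by
  have := cond μ hn t {t 0} (Nice.const 1) (fun _ _ _ => rfl)
  unfold ES
  simp only [one_mul] at this
  rw [this]
  refine (integral_congr_ae (g := fun _ => (0:ℝ)) (Eventually.of_forall fun X => ?_)).trans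
    (integral_zero _ _)
  show _ = (0:ℝ)
  rw [← inner_one μ hn hdeg t ht 0 (X (t 0))]
  congr 1; ext Y; congr 1; ext i
  by_cases hi : i = 0
  · subst hi; simp
  · simp [hi, ht.eq_iff]

theorem EP_one (hn : Nice h)
    (hdeg : ∀ c x, ∫ z, h (Function.update z c x) ∂(Measure.pi fun _ => μ) = 0)
    (s t : Fin 4 → Fin n) (ht : Function.Injective t) (c : Fin 4)
    (hc : t c ∈ Set.range s) (hc' : ∀ i, t i ∈ Set.range s → i = c) : EP μ h s t = 0 := by
  classical
  unfold EP
  rw [cond μ hn t (Set.range s) (nice_comp hn s)]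
  · refine (integral_congr_ae (g := fun _ => (0:ℝ)) (Eventually.of_forall fun X => ?_)).trans
      (integral_zero _ _)
    show _ * _ = (0:ℝ)
    rw [← mul_zero, ← inner_one μ hn hdeg t ht c (X (t c))]
    congr 2; ext Y; congr 1; ext i
    by_cases hi : i = c
    · subst hi; simp only [hc, if_true, Function.update_self]
    · have : t i ∉ Set.range s := fun h => hi (hc' i h)
      simp only [this, if_false]; simp [hi]
  · intro X Y hXY
    congr 1; ext i; exact hXY _ ⟨i, rfl⟩

open Classical in
theorem inner_two (hn : Nice h) (hs : ∀ (z : Fin 4 → Ω) (σ : Equiv.Perm (Fin 4)), h (z ∘ σ) = h z)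
    (t : Fin 4 → Fin n) (ht : Function.Injective t) (S : Set (Fin n)) (c e : Fin 4) (hce : c ≠ e)
    (hS : ∀ i, t i ∈ S ↔ (i = c ∨ i = e)) (X : Fin n → Ω) :
    ∫ Y : Fin n → Ω, h (fun i => if t i ∈ S then X (t i) else Y (t i)) ∂(Measure.pi fun _ => μ)
      = h2 μ h (X (t c), X (t e)) := by
  obtain ⟨σ, h0, h1⟩ : ∃ σ : Equiv.Perm (Fin 4), σ 0 = c ∧ σ 1 = e := by
    clear hS
    revert c e; decide
  have h2c : σ 2 ≠ c := by rw [← h0]; simp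
  have h2e : σ 2 ≠ e := by rw [← h1]; simp
  have h3c : σ 3 ≠ c := by rw [← h0]; simp
  have h3e : σ 3 ≠ e := by rw [← h1]; simp
  unfold h2
  have hn' : Nice (fun z : Fin 4 → Ω => h ![X (t c), X (t e), z 2, z 3]) := by
    refine hn.comp ?_
    refine measurable_pi_lambda _ fun i => ?_
    fin_cases i <;> simp <;> fun_prop
  rw [mp_integral (marg μ (fun i => t (σ i)) (ht.comp σ.injective)) hn']
  congr 1; ext Y
  rw [← hs _ σ]
  congr 1; ext i
  fin_cases i <;> simp [hS, h0, h1, h2c, h2e, h3c, h3e]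

theorem EP_two (hn : Nice h) (hs : ∀ (z : Fin 4 → Ω) (σ : Equiv.Perm (Fin 4)), h (z ∘ σ) = h z)
    (s t : Fin 4 → Fin n) (hsi : Function.Injective s) (ht : Function.Injective t)
    (a b c e : Fin 4) (hab : a ≠ b) (hce : c ≠ e) (hac : s a = t c) (hbe : s b = t e)
    (hS : ∀ i, t i ∈ Set.range s → (i = c ∨ i = e)) :
    EP μ h s t = ∫ x, ∫ y, h2 μ h (x, y) ^ 2 ∂μ ∂μ := by
  classical
  unfold EP
  rw [cond μ hn t (Set.range s) (nice_comp hn s)]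
  · have hS' : ∀ i, t i ∈ Set.range s ↔ (i = c ∨ i = e) := by
      refine fun i => ⟨hS i, ?_⟩
      rintro (rfl | rfl)
      exacts [⟨a, hac⟩, ⟨b, hbe⟩]
    simp only [inner_two μ hn hs t ht _ c e hce hS']
    rw [← hac, ← hbe]
    have h2n := h2_nice μ h hn
    have hnp : Nice (fun X : Fin n → Ω => h2 μ h (X (s a), X (s b))) := h2n.comp (by fun_prop)
    simp_rw [mul_comm (h _)]
    rw [cond μ hn s {s a, s b} hnp]
    · have hS'' : ∀ i, s i ∈ ({s a, s b} : Set (Fin n)) ↔ (i = a ∨ i = b) := by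
        intro i; simp [hsi.eq_iff]
      simp only [inner_two μ hn hs s hsi _ a b hab hS'']
      rw [← pair_int μ (f := fun p => h2 μ h p ^ 2) (by simpa only [sq] using h2n.mul h2n)
        (s a) (s b) (hsi.ne hab)]
      simp only [sq]
    · intro X Y hXY
      rw [hXY (s a) (by simp), hXY (s b) (by simp)]
  · intro X Y hXY
    congr 1; ext i; exact hXY _ ⟨i, rfl⟩

/-- coincidence patterns -/
def pat : Finset ((Fin 4 × Fin 4) × (Fin 4 × Fin 4)) :=
  Finset.univ.filter fun q => q.1.1 ≠ q.1.2 ∧ q.2.1 < q.2.2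

theorem pat_card : pat.card = 72 := by decide +kernel

/-- number of coincidences -/
def NC (s t : Fin 4 → Fin n) : ℕ :=
  (pat.filter fun q => s q.1.1 = t q.2.1 ∧ s q.1.2 = t q.2.2).card

theorem NC_le (s t : Fin 4 → Fin n) : NC s t ≤ 72 :=
  (Finset.card_filter_le _ _).trans pat_card.le

theorem cov_large (hn : Nice h)
    (hs : ∀ (z : Fin 4 → Ω) (σ : Equiv.Perm (Fin 4)), h (z ∘ σ) = h z)
    (hdeg : ∀ c x, ∫ z, h (Function.update z c x) ∂(Measure.pi fun _ => μ) = 0)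
    (s t : Fin 4 → Fin n) (hl : 6 ≤ (Finset.univ.image s ∪ Finset.univ.image t).card) :
    EP μ h s t - ES μ h s * ES μ h t = NC s t * ∫ x, ∫ y, h2 μ h (x, y) ^ 2 ∂μ ∂μ := by
  have hu := Finset.card_union_add_card_inter (Finset.univ.image s) (Finset.univ.image t)
  have hs4 : (Finset.univ.image s).card ≤ 4 := Finset.card_image_le
  have ht4 : (Finset.univ.image t).card ≤ 4 := Finset.card_image_le
  have inj (u : Fin 4 → Fin n) (hu : (Finset.univ.image u).card = 4) : Function.Injective u := by
    have := (Finset.card_image_iff (s := (Finset.univ : Finset (Fin 4))) (f := u)).1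
      (by rw [hu]; simp)
    simpa [Set.injOn_univ] using this
  set I := Finset.univ.image s ∩ Finset.univ.image t with hI
  have memI : ∀ y, y ∈ I ↔ (∃ a, s a = y) ∧ (∃ c, t c = y) := by intro y; simp [hI]
  have hNC0 : (∀ a b c e, a ≠ b → c < e → s a = t c → s b ≠ t e) → NC s t = 0 := by
    intro H
    unfold NC
    rw [Finset.card_eq_zero, Finset.filter_eq_empty_iff]
    rintro ⟨⟨a, b⟩, ⟨c, e⟩⟩ hq ⟨h1, h2⟩
    simp only [pat, Finset.mem_filter, Finset.mem_univ, true_and] at hq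
    exact H a b c e hq.1 hq.2 h1 h2
  rcases Nat.lt_trichotomy I.card 1 with h0 | h1 | h2
  · have h0 : I = ∅ := by rw [← Finset.card_eq_zero]; omega
    have hd : ∀ a c, s a ≠ t c := by
      intro a c hac
      have : t c ∈ I := (memI _).2 ⟨⟨a, hac⟩, ⟨c, rfl⟩⟩
      rw [h0] at this; simp at this
    rw [cov_disj μ hn s t hd, hNC0 fun a b c e _ _ h1 => absurd h1 (hd a c)]
    simp
  · obtain ⟨y, hy⟩ := Finset.card_eq_one.1 h1
    obtain ⟨⟨a, ha⟩, ⟨c, hc⟩⟩ := (memI y).1 (by rw [hy]; simp)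
    have hone : ∀ y', (∃ a, s a = y') → (∃ c, t c = y') → y' = y := by
      intro y' h1 h2
      have := (memI y').2 ⟨h1, h2⟩
      rw [hy] at this; simpa using this
    have : Function.Injective s ∨ Function.Injective t := by
      by_cases h : (Finset.univ.image s).card = 4
      · exact Or.inl (inj s h)
      · exact Or.inr (inj t (by omega))
    rw [hNC0 ?_]
    · rcases this with hi | hi
      · rw [EP_comm, EP_one μ hn hdeg t s hi a ⟨c, by rw [hc, ha]⟩, ES_zero μ hn hdeg s hi]
        · simp
        · intro i hi'
          apply hi
          rw [ha]
          exact hone _ ⟨i, rfl⟩ hi'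
      · rw [EP_one μ hn hdeg s t hi c ⟨a, by rw [hc, ha]⟩, ES_zero μ hn hdeg t hi]
        · simp
        · intro i hi'
          apply hi
          rw [hc]
          exact hone _ hi' ⟨i, rfl⟩
    · intro a' b' c' e' hab hce h1 h2
      have e1 := hone (s a') ⟨a', rfl⟩ ⟨c', h1.symm⟩
      have e2 := hone (s b') ⟨b', rfl⟩ ⟨e', h2.symm⟩
      rcases this with hi | hi
      · exact hab (hi (e1.trans e2.symm))
      · exact hce.ne (hi (by rw [← h1, ← h2, e1, e2]))
  · have his := inj s (by omega)
    have hit := inj t (by omega)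
    have h2' : I.card = 2 := by omega
    obtain ⟨y, y', hyy, hy⟩ := Finset.card_eq_two.1 h2'
    have key : ∃ a b c e, a ≠ b ∧ c < e ∧ s a = t c ∧ s b = t e ∧ I = {t c, t e} := by
      obtain ⟨⟨a, ha⟩, ⟨c, hc⟩⟩ := (memI y).1 (by rw [hy]; simp)
      obtain ⟨⟨b, hb⟩, ⟨e, he⟩⟩ := (memI y').1 (by rw [hy]; simp)
      have hab : a ≠ b := by rintro rfl; exact hyy (ha.symm.trans hb)
      have hce : c ≠ e := by rintro rfl; exact hyy (hc.symm.trans he)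
      rcases lt_or_gt_of_ne hce with hlt | hlt
      · exact ⟨a, b, c, e, hab, hlt, by rw [ha, hc], by rw [hb, he], by rw [hy, hc, he]⟩
      · exact ⟨b, a, e, c, hab.symm, hlt, by rw [hb, he], by rw [ha, hc],
          by rw [hy, hc, he, Finset.pair_comm]⟩
    obtain ⟨a, b, c, e, hab, hce, hac, hbe, hIe⟩ := key
    have hrange : ∀ i, t i ∈ Set.range s → i = c ∨ i = e := by
      intro i hi
      have : t i ∈ I := (memI _).2 ⟨hi, ⟨i, rfl⟩⟩
      rw [hIe] at this
      simpa [hit.eq_iff] using this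
    rw [EP_two μ hn hs s t his hit a b c e hab hce.ne hac hbe hrange, ES_zero μ hn hdeg s his]
    have : NC s t = 1 := by
      unfold NC
      rw [Finset.card_eq_one]
      refine ⟨((a, b), (c, e)), ?_⟩
      ext ⟨⟨a', b'⟩, ⟨c', e'⟩⟩
      simp only [pat, Finset.mem_filter, Finset.mem_univ, true_and, Finset.mem_singleton,
        Prod.mk.injEq]
      constructor
      · rintro ⟨⟨h1, h2⟩, h3, h4⟩
        have hc' := hrange c' ⟨a', h3⟩
        have he' := hrange e' ⟨b', h4⟩
        have : c' = c ∧ e' = e := by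
          rcases hc' with rfl | rfl <;> rcases he' with rfl | rfl
          · exact absurd h2 (lt_irrefl _)
          · exact ⟨rfl, rfl⟩
          · exact absurd h2 (lt_asymm hce)
          · exact absurd h2 (lt_irrefl _)
        obtain ⟨rfl, rfl⟩ := this
        exact ⟨⟨his (h3.trans hac.symm), his (h4.trans hbe.symm)⟩, rfl, rfl⟩
      · rintro ⟨⟨rfl, rfl⟩, rfl, rfl⟩
        exact ⟨⟨hab, hce⟩, hac, hbe⟩
    rw [this]; simp

theorem small_factor (s t : Fin 4 → Fin n)
    (hst : (Finset.univ.image s ∪ Finset.univ.image t).card < 6) :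
    ∃ (p q : Fin 4 → Fin 5) (v : Fin 5 → Fin n), (v ∘ p, v ∘ q) = (s, t) := by
  have hsS : ∀ i, s i ∈ Finset.univ.image s ∪ Finset.univ.image t := fun i => by simp
  have htS : ∀ i, t i ∈ Finset.univ.image s ∪ Finset.univ.image t := fun i => by simp
  generalize Finset.univ.image s ∪ Finset.univ.image t = S at *
  have he : Nonempty (S ↪ Fin 5) := by
    apply Function.Embedding.nonempty_of_card_le
    rw [Fintype.card_coe, Fintype.card_fin]
    omega
  have e : S ↪ Fin 5 := Classical.choice he
  have : Nonempty S := ⟨⟨s 0, hsS 0⟩⟩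
  refine ⟨fun i => e ⟨s i, hsS i⟩, fun i => e ⟨t i, htS i⟩,
      fun i => (Function.invFun e i).1, ?_⟩
  rw [Prod.mk.injEq]
  constructor <;> ext i <;> simp [Function.leftInverse_invFun e.injective _]

theorem card_gen {α β : Type*} [Fintype α] [Fintype β] (P : β → Prop)
    [DecidablePred P] (f : α → β) (H : ∀ b, P b → ∃ a, f a = b) :
    (Finset.univ.filter P).card ≤ Fintype.card α := by
  classical
  rw [← Finset.card_univ]
  refine (Finset.card_le_card (t := Finset.univ.image f) ?_).trans Finset.card_image_le
  intro b hb
  obtain ⟨a, ha⟩ := H b (Finset.mem_filter.1 hb).2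
  exact Finset.mem_image.2 ⟨a, Finset.mem_univ _, ha⟩

theorem small_card :
    (Finset.univ.filter fun p : (Fin 4 → Fin n) × (Fin 4 → Fin n) =>
      (Finset.univ.image p.1 ∪ Finset.univ.image p.2).card < 6).card ≤ 5 ^ 8 * n ^ 5 := by
  refine (card_gen (α := ((Fin 4 → Fin 5) × (Fin 4 → Fin 5)) × (Fin 5 → Fin n)) _
    (fun q => (q.2 ∘ q.1.1, q.2 ∘ q.1.2)) fun st hst => ?_).trans ?_
  · obtain ⟨p, q, v, h⟩ := small_factor st.1 st.2 hst
    exact ⟨((p, q), v), h⟩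
  rw [Fintype.card_prod, Fintype.card_prod, Fintype.card_fun, Fintype.card_fun,
    Fintype.card_fin, Fintype.card_fin, Fintype.card_fin, ← pow_add]

theorem fib_card (c e : Fin 4) (hce : c < e) (x y : Fin n) :
    (Finset.univ.filter fun t : Fin 4 → Fin n => x = t c ∧ y = t e).card = n ^ 2 := by
  have : (Finset.univ.filter fun t : Fin 4 → Fin n => x = t c ∧ y = t e) =
      Fintype.piFinset (fun i => if i = c then {x} else if i = e then {y} else Finset.univ) := by
    ext t
    simp only [Finset.mem_filter, Finset.mem_univ, true_and, Fintype.mem_piFinset]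
    constructor
    · rintro ⟨rfl, rfl⟩ i
      by_cases h1 : i = c
      · simp [h1]
      · by_cases h2 : i = e <;> simp [h1, h2, hce.ne']
    · intro H
      have h1 := H c
      have h2 := H e
      simp only [if_true, hce.ne', if_false, Finset.mem_singleton] at h1 h2
      exact ⟨h1.symm, h2.symm⟩
  rw [this, Fintype.card_piFinset]
  rw [Fin.prod_univ_four]
  fin_cases c <;> fin_cases e <;> simp at hce ⊢ <;> ring

theorem NC_sum : ∑ s : Fin 4 → Fin n, ∑ t : Fin 4 → Fin n, NC s t = 72 * n ^ 6 := by
  unfold NC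
  simp_rw [Finset.card_filter]
  have : ∀ s : Fin 4 → Fin n, ∑ t : Fin 4 → Fin n, ∑ q ∈ pat,
      (if s q.1.1 = t q.2.1 ∧ s q.1.2 = t q.2.2 then 1 else 0) = 72 * n ^ 2 := by
    intro s
    rw [Finset.sum_comm]
    rw [← pat_card, ← smul_eq_mul]
    refine Finset.sum_eq_card_nsmul fun q hq => ?_
    simp only [pat, Finset.mem_filter, Finset.mem_univ, true_and] at hq
    rw [← Finset.card_filter]
    exact fib_card _ _ hq.2 _ _
  simp_rw [this]
  simp
  ring

theorem var_expand (hn : Nice h) :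
    ∫ X : Fin n → Ω, ((∑ t : Fin 4 → Fin n, h (fun i => X (t i))) -
      ∑ t : Fin 4 → Fin n, ES μ h t) ^ 2 ∂(Measure.pi fun _ => μ) =
      ∑ s : Fin 4 → Fin n, ∑ t : Fin 4 → Fin n, (EP μ h s t - ES μ h s * ES μ h t) := by
  simp_rw [← Finset.sum_sub_distrib, sq, Finset.sum_mul_sum]
  have hns (s : Fin 4 → Fin n) : Nice (fun X : Fin n → Ω => h (fun i => X (s i)) - ES μ h s) :=
    (nice_comp hn s).sub (Nice.const _)
  rw [integral_finsetSum _ fun s _ => (Nice.sum _ fun t => (hns s).mul (hns t)).integrable _]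
  refine Finset.sum_congr rfl fun s _ => ?_
  rw [integral_finsetSum _ fun t _ => ((hns s).mul (hns t)).integrable _]
  refine Finset.sum_congr rfl fun t _ => ?_
  have e1 : ∀ X : Fin n → Ω, (h (fun i => X (s i)) - ES μ h s) * (h (fun i => X (t i)) - ES μ h t)
    = h (fun i => X (s i)) * h (fun i => X (t i)) - ES μ h t * h (fun i => X (s i))
      - (ES μ h s * h (fun i => X (t i)) - ES μ h s * ES μ h t) := by intro X; ring
  simp_rw [e1]
  have n1 := (nice_comp hn s).mul (nice_comp hn t)
  have n2 := (Nice.const (ES μ h t)).mul (nice_comp hn s)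
  have n3 := (Nice.const (ES μ h s)).mul (nice_comp hn t)
  have n4 := Nice.const (Ω := Fin n → Ω) (ES μ h s * ES μ h t)
  rw [integral_sub ((n1.sub n2).integrable _) ((n3.sub n4).integrable _),
    integral_sub (n1.integrable _) (n2.integrable _),
    integral_sub (n3.integrable _) (n4.integrable _), integral_const_mul, integral_const_mul]
  unfold EP ES
  simp
  ring

theorem var_bound (hn : Nice h)
    (hs : ∀ (z : Fin 4 → Ω) (σ : Equiv.Perm (Fin 4)), h (z ∘ σ) = h z)
    (hdeg : ∀ c x, ∫ z, h (Function.update z c x) ∂(Measure.pi fun _ => μ) = 0) :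
    ∃ K : ℝ, ∀ n : ℕ, 1 ≤ n →
      |∫ X : Fin n → Ω, ((∑ t : Fin 4 → Fin n, h (fun i => X (t i))) -
        ∫ X : Fin n → Ω, (∑ t : Fin 4 → Fin n, h (fun i => X (t i))) ∂(Measure.pi fun _ => μ)) ^ 2
          ∂(Measure.pi fun _ => μ) - 72 * n ^ 6 * ∫ x, ∫ y, h2 μ h (x, y) ^ 2 ∂μ ∂μ|
        ≤ K * n ^ 5 := by
  obtain ⟨B, hB⟩ := hn.2
  set ζ := ∫ x, ∫ y, h2 μ h (x, y) ^ 2 ∂μ ∂μ with hζ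
  have hB0 : 0 ≤ B := by
    obtain ⟨x⟩ : Nonempty Ω := by
      by_contra hne
      rw [not_nonempty_iff] at hne
      have := measure_univ (μ := μ)
      rw [Set.univ_eq_empty_iff.2 hne] at this
      simp at this
    exact (abs_nonneg _).trans (hB fun _ => x)
  refine ⟨(B * B + B * B + 72 * |ζ|) * 5 ^ 8, fun n _ => ?_⟩
  have hsum : ∫ X : Fin n → Ω, (∑ t : Fin 4 → Fin n, h (fun i => X (t i)))
      ∂(Measure.pi fun _ => μ) = ∑ t : Fin 4 → Fin n, ES μ h t :=
    integral_finsetSum _ fun t _ => (nice_comp hn t).integrable _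
  rw [hsum, var_expand μ hn]
  have hN : (72 * n ^ 6 * ζ : ℝ) = ∑ s : Fin 4 → Fin n, ∑ t : Fin 4 → Fin n, (NC s t * ζ : ℝ) := by
    simp_rw [← Finset.sum_mul]
    congr 1
    exact_mod_cast (NC_sum (n := n)).symm
  rw [hN]
  simp_rw [← Finset.sum_sub_distrib]
  rw [← Fintype.sum_prod_type' (f := fun s t : Fin 4 → Fin n =>
    EP μ h s t - ES μ h s * ES μ h t - NC s t * ζ)]
  refine (Finset.abs_sum_le_sum_abs _ _).trans ?_
  have hES (s : Fin 4 → Fin n) : |ES μ h s| ≤ B := by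
    have := norm_integral_le_of_norm_le_const (μ := Measure.pi fun _ : Fin n => μ)
      (f := fun X => h (fun i => X (s i))) (C := B) (Eventually.of_forall fun y => hB _)
    simpa [ES] using this
  have hEP (s t : Fin 4 → Fin n) : |EP μ h s t| ≤ B * B := by
    have := norm_integral_le_of_norm_le_const (μ := Measure.pi fun _ : Fin n => μ)
      (f := fun X => h (fun i => X (s i)) * h (fun i => X (t i))) (C := B * B)
      (Eventually.of_forall fun y => by
        rw [norm_mul]; exact mul_le_mul (hB _) (hB _) (abs_nonneg _) hB0)
    simpa [EP] using this
  rw [← Finset.sum_filter_add_sum_filter_not _ (fun p : (Fin 4 → Fin n) × (Fin 4 → Fin n) =>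
      (Finset.univ.image p.1 ∪ Finset.univ.image p.2).card < 6)]
  rw [Finset.sum_eq_zero (s := Finset.filter (fun p => ¬ _) _), add_zero]
  · refine (Finset.sum_le_card_nsmul _ _ (B * B + B * B + 72 * |ζ|) fun p _ => ?_).trans ?_
    · refine (abs_sub _ _).trans (add_le_add ((abs_sub _ _).trans (add_le_add (hEP _ _) ?_)) ?_)
      · rw [abs_mul]; exact mul_le_mul (hES _) (hES _) (abs_nonneg _) hB0
      · rw [abs_mul]
        refine mul_le_mul_of_nonneg_right ?_ (abs_nonneg _)
        rw [Nat.abs_cast]; exact_mod_cast NC_le _ _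
    · rw [nsmul_eq_mul]
      have : ((Finset.univ.filter fun p : (Fin 4 → Fin n) × (Fin 4 → Fin n) =>
        (Finset.univ.image p.1 ∪ Finset.univ.image p.2).card < 6).card : ℝ) ≤ 5 ^ 8 * n ^ 5 := by
        exact_mod_cast small_card
      refine (mul_le_mul_of_nonneg_right this (by positivity)).trans (le_of_eq (by ring))
  · intro p hp
    simp only [Finset.mem_filter, Finset.mem_univ, true_and, not_lt] at hp
    rw [cov_large μ hn hs hdeg p.1 p.2 hp, ← hζ]
    simp

end abs

theorem rate (Var : ℕ → ℝ) (ζ K : ℝ)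
    (H : ∀ n : ℕ, 1 ≤ n → |(n:ℝ) ^ 8 * Var n - 72 * n ^ 6 * ζ| ≤ K * n ^ 5) :
    Tendsto (fun n : ℕ => (n : ℝ) ^ 2 * Var n) atTop (nhds (72 * ζ)) ∧
      ∃ c : ℝ, ∀ n : ℕ, 4 ≤ n →
        |Var n - (72 * ((n : ℝ) - 4) * ((n : ℝ) - 5)
            / ((n : ℝ) * ((n : ℝ) - 1) * ((n : ℝ) - 2) * ((n : ℝ) - 3))) * ζ|
          ≤ c / (n : ℝ) ^ 3 := by
  have H' : ∀ n : ℕ, 1 ≤ n → |Var n - 72 / n ^ 2 * ζ| ≤ K / n ^ 3 := by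
    intro n hn
    have hp : (0:ℝ) < n := by exact_mod_cast hn
    have e : (n:ℝ) ^ 8 * Var n - 72 * n ^ 6 * ζ = n ^ 8 * (Var n - 72 / n ^ 2 * ζ) := by
      field_simp
    have := H n hn
    rw [e, abs_mul, abs_of_pos (by positivity)] at this
    rw [le_div_iff₀ (by positivity)]
    have h5 : (0:ℝ) < n ^ 5 := by positivity
    refine le_of_mul_le_mul_right ?_ h5
    calc _ = (n:ℝ) ^ 8 * |Var n - 72 / n ^ 2 * ζ| := by ring
      _ ≤ _ := this
  constructor
  · rw [tendsto_iff_norm_sub_tendsto_zero]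
    refine squeeze_zero' (g := fun n : ℕ => K / (n:ℝ)) (Eventually.of_forall fun _ => norm_nonneg _) ?_
      (tendsto_const_div_atTop_nhds_zero_nat K)
    filter_upwards [eventually_ge_atTop 1] with n hn
    have hp : (0:ℝ) < n := by exact_mod_cast hn
    have e : (n:ℝ) ^ 2 * Var n - 72 * ζ = n ^ 2 * (Var n - 72 / n ^ 2 * ζ) := by
      field_simp
    rw [e, norm_mul, Real.norm_eq_abs, Real.norm_eq_abs, abs_of_pos (by positivity)]
    refine (mul_le_mul_of_nonneg_left (H' n hn) (by positivity)).trans (le_of_eq ?_)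
    field_simp
  · refine ⟨K + 2160 * |ζ|, fun n hn => ?_⟩
    have hp : (4:ℝ) ≤ n := by exact_mod_cast hn
    have p0 : (0:ℝ) < n := by linarith
    have p1 : (0:ℝ) < (n:ℝ) - 1 := by linarith
    have p2 : (0:ℝ) < (n:ℝ) - 2 := by linarith
    have p3 : (0:ℝ) < (n:ℝ) - 3 := by linarith
    set x : ℝ := (n : ℝ) with hx
    have e : Var n - (72 * (x - 4) * (x - 5) / (x * (x - 1) * (x - 2) * (x - 3))) * ζ =
      (Var n - 72 / x ^ 2 * ζ) +
        (216 * (x ^ 2 - 3 * x - 2) / (x ^ 2 * ((x - 1) * (x - 2) * (x - 3)))) * ζ := by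
      field_simp
      ring
    rw [e]
    refine (abs_add_le _ _).trans ?_
    rw [add_div]
    refine add_le_add (H' n (by omega)) ?_
    rw [abs_mul, show 2160 * |ζ| / x ^ 3 = 2160 / x ^ 3 * |ζ| by ring]
    refine mul_le_mul_of_nonneg_right ?_ (abs_nonneg _)
    have q : 0 ≤ x ^ 2 - 3 * x - 2 := by nlinarith
    rw [abs_of_nonneg (by positivity), div_le_div_iff₀ (by positivity) (by positivity)]
    have key : x * (x ^ 2 - 3 * x - 2) ≤ 10 * ((x - 1) * (x - 2) * (x - 3)) := by
      obtain ⟨y, hy⟩ : ∃ y, x = y + 4 := ⟨x - 4, by ring⟩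
      have : 0 ≤ y := by linarith
      rw [hy]
      nlinarith [pow_nonneg this 3, pow_nonneg this 2]
    nlinarith [mul_le_mul_of_nonneg_left key (show 0 ≤ 216 * x ^ 2 by positivity)]

section core
variable (μ : Measure Ω) [IsProbabilityMeasure μ] (α β : Ω → Ω → ℝ) (W : Ω → ℝ)

/-- first part -/
def T1 (z : Fin 4 → Ω) : ℝ := α (z 0) (z 1) * β (z 0) (z 1) * W (z 0) * W (z 1)
/-- second part -/
def T2 (z : Fin 4 → Ω) : ℝ :=
  α (z 0) (z 1) * β (z 2) (z 3) * W (z 0) * W (z 1) * W (z 2) * W (z 3)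
/-- third part -/
def T3 (z : Fin 4 → Ω) : ℝ := 2 * α (z 0) (z 1) * β (z 0) (z 2) * W (z 0) * W (z 1) * W (z 2)

variable {α β W}
theorem T1_nice (hα : Nice (Function.uncurry α)) (hβ : Nice (Function.uncurry β)) (hW : Nice W) :
    Nice (T1 α β W) := by
  have a (i : Fin 4) : Nice (fun z : Fin 4 → Ω => W (z i)) := hW.comp (by fun_prop)
  have b (i j : Fin 4) : Nice (fun z : Fin 4 → Ω => α (z i) (z j)) :=
    hα.comp (g := fun z : Fin 4 → Ω => (z i, z j)) (by fun_prop)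
  have c (i j : Fin 4) : Nice (fun z : Fin 4 → Ω => β (z i) (z j)) :=
    hβ.comp (g := fun z : Fin 4 → Ω => (z i, z j)) (by fun_prop)
  exact (((b 0 1).mul (c 0 1)).mul (a 0)).mul (a 1)

theorem T2_nice (hα : Nice (Function.uncurry α)) (hβ : Nice (Function.uncurry β)) (hW : Nice W) :
    Nice (T2 α β W) := by
  have a (i : Fin 4) : Nice (fun z : Fin 4 → Ω => W (z i)) := hW.comp (by fun_prop)
  have b (i j : Fin 4) : Nice (fun z : Fin 4 → Ω => α (z i) (z j)) :=
    hα.comp (g := fun z : Fin 4 → Ω => (z i, z j)) (by fun_prop)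
  have c (i j : Fin 4) : Nice (fun z : Fin 4 → Ω => β (z i) (z j)) :=
    hβ.comp (g := fun z : Fin 4 → Ω => (z i, z j)) (by fun_prop)
  exact (((((b 0 1).mul (c 2 3)).mul (a 0)).mul (a 1)).mul (a 2)).mul (a 3)

theorem T3_nice (hα : Nice (Function.uncurry α)) (hβ : Nice (Function.uncurry β)) (hW : Nice W) :
    Nice (T3 α β W) := by
  have a (i : Fin 4) : Nice (fun z : Fin 4 → Ω => W (z i)) := hW.comp (by fun_prop)
  have b (i j : Fin 4) : Nice (fun z : Fin 4 → Ω => α (z i) (z j)) :=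
    hα.comp (g := fun z : Fin 4 → Ω => (z i, z j)) (by fun_prop)
  have c (i j : Fin 4) : Nice (fun z : Fin 4 → Ω => β (z i) (z j)) :=
    hβ.comp (g := fun z : Fin 4 → Ω => (z i, z j)) (by fun_prop)
  exact (((((Nice.const 2).mul (b 0 1)).mul (c 0 2)).mul (a 0)).mul (a 1)).mul (a 2)

theorem up0 (x a b c e : Ω) : Function.update ![a, b, c, e] 0 x = ![x, b, c, e] := by
  ext i; fin_cases i <;> rfl
theorem up1 (x a b c e : Ω) : Function.update ![a, b, c, e] 1 x = ![a, x, c, e] := by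
  ext i; fin_cases i <;> rfl
theorem up2 (x a b c e : Ω) : Function.update ![a, b, c, e] 2 x = ![a, b, x, e] := by
  ext i; fin_cases i <;> rfl
theorem up3 (x a b c e : Ω) : Function.update ![a, b, c, e] 3 x = ![a, b, c, x] := by
  ext i; fin_cases i <;> rfl

theorem T1_ap (a b c e : Ω) : T1 α β W ![a, b, c, e] = α a b * β a b * W a * W b := rfl
theorem T2_ap (a b c e : Ω) :
    T2 α β W ![a, b, c, e] = α a b * β c e * W a * W b * W c * W e := rfl
theorem T3_ap (a b c e : Ω) :
    T3 α β W ![a, b, c, e] = 2 * α a b * β a c * W a * W b * W c := rfl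

theorem deg0 (hα : Nice (Function.uncurry α)) (hβ : Nice (Function.uncurry β)) (hW : Nice W)
    (hαs : ∀ x y, α x y = α y x) (hβs : ∀ x y, β x y = β y x)
    (P Q : Ω → ℝ) (P0 Q0 : ℝ)
    (hP : ∀ x, ∫ z, α x z * W z ∂μ = P x) (hQ : ∀ x, ∫ z, β x z * W z ∂μ = Q x)
    (hP0 : ∫ z, P z * W z ∂μ = P0) (hQ0 : ∫ z, Q z * W z ∂μ = Q0)
    (f1 : ∀ x, ∫ z, α x z * β x z * W z ∂μ = P x * Q x)
    (f2 : ∀ x, ∫ z, α x z * Q z * W z ∂μ = P x * Q0)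
    (f3 : ∀ x, ∫ z, P z * β x z * W z ∂μ = P0 * Q x)
    (f4 : ∫ z, P z * Q z * W z ∂μ = P0 * Q0) (x : Ω) :
    ∑ r : Fin 4, ∫ z, (T1 α β W (Function.update z r x) + T2 α β W (Function.update z r x)
      - T3 α β W (Function.update z r x)) ∂(Measure.pi fun _ => μ) = 0 := by
  have n1 (r : Fin 4) : Nice (fun z => T1 α β W (Function.update z r x)) :=
    (T1_nice hα hβ hW).comp (by fun_prop)
  have n2 (r : Fin 4) : Nice (fun z => T2 α β W (Function.update z r x)) :=
    (T2_nice hα hβ hW).comp (by fun_prop)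
  have n3 (r : Fin 4) : Nice (fun z => T3 α β W (Function.update z r x)) :=
    (T3_nice hα hβ hW).comp (by fun_prop)
  have split (r : Fin 4) : ∫ z, (T1 α β W (Function.update z r x) + T2 α β W (Function.update z r x)
      - T3 α β W (Function.update z r x)) ∂(Measure.pi fun _ => μ) =
      ∫ z, T1 α β W (Function.update z r x) ∂(Measure.pi fun _ => μ) +
      ∫ z, T2 α β W (Function.update z r x) ∂(Measure.pi fun _ => μ) -
      ∫ z, T3 α β W (Function.update z r x) ∂(Measure.pi fun _ => μ) := by
    rw [integral_sub (((n1 r).add (n2 r)).integrable _) ((n3 r).integrable _),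
      integral_add ((n1 r).integrable _) ((n2 r).integrable _)]
  simp_rw [split]
  have a10 : ∫ z, T1 α β W (Function.update z 0 x) ∂(Measure.pi fun _ => μ) = W x * (P x * Q x) := by
    rw [pi_four μ (n1 0)]
    simp only [up0, T1_ap]
    have e : ∀ b, α x b * β x b * W x * W b = W x * (α x b * β x b * W b) := by intros; ring
    simp only [e, integral_const_mul, f1, integral_const, probReal_univ, one_smul]
  have a11 : ∫ z, T1 α β W (Function.update z 1 x) ∂(Measure.pi fun _ => μ) = W x * (P x * Q x) := by
    rw [pi_four μ (n1 1)]
    simp only [up1, T1_ap]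
    have e : ∀ b, α b x * β b x * W b * W x = W x * (α x b * β x b * W b) := by
      intro b; rw [hαs b x, hβs b x]; ring
    simp only [e, integral_const_mul, f1, integral_const, probReal_univ, one_smul]
  have e1 : ∀ a b, α a b * β a b * W a * W b = W a * (α a b * β a b * W b) := by intros; ring
  have e1' : ∀ a, W a * (P a * Q a) = P a * Q a * W a := by intros; ring
  have a12 : ∫ z, T1 α β W (Function.update z 2 x) ∂(Measure.pi fun _ => μ) = P0 * Q0 := by
    rw [pi_four μ (n1 2)]
    simp only [up2, T1_ap]
    simp only [integral_const, probReal_univ, one_smul, e1, integral_const_mul, f1]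
    simp only [e1', f4]
  have a13 : ∫ z, T1 α β W (Function.update z 3 x) ∂(Measure.pi fun _ => μ) = P0 * Q0 := by
    rw [pi_four μ (n1 3)]
    simp only [up3, T1_ap]
    simp only [integral_const, probReal_univ, one_smul, e1, integral_const_mul, f1]
    simp only [e1', f4]
  have a20 : ∫ z, T2 α β W (Function.update z 0 x) ∂(Measure.pi fun _ => μ) = W x * P x * Q0 := by
    rw [pi_four μ (n2 0)]
    simp only [up0, T2_ap]
    have e : ∀ b c e, α x b * β c e * W x * W b * W c * W e =
      (W x * (α x b * W b)) * (W c * (β c e * W e)) := by intros; ring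
    simp only [e, integral_const_mul, hQ]
    simp only [mul_comm (W _) (Q _), hQ0, integral_mul_const, integral_const_mul, hP,
      integral_const, probReal_univ, one_smul]
  have a21 : ∫ z, T2 α β W (Function.update z 1 x) ∂(Measure.pi fun _ => μ) = W x * P x * Q0 := by
    rw [pi_four μ (n2 1)]
    simp only [up1, T2_ap]
    have e : ∀ b c e, α b x * β c e * W b * W x * W c * W e =
      (W x * (α x b * W b)) * (W c * (β c e * W e)) := by intro b c e; rw [hαs b x]; ring
    simp only [e, integral_const_mul, hQ]
    simp only [mul_comm (W _) (Q _), hQ0, integral_mul_const, integral_const_mul, hP,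
      integral_const, probReal_univ, one_smul]
  have a22 : ∫ z, T2 α β W (Function.update z 2 x) ∂(Measure.pi fun _ => μ) = W x * Q x * P0 := by
    rw [pi_four μ (n2 2)]
    simp only [up2, T2_ap]
    have e : ∀ a b e, α a b * β x e * W a * W b * W x * W e =
      (W a * (α a b * W b)) * (W x * (β x e * W e)) := by intros; ring
    simp only [e, integral_const_mul, hQ]
    simp only [integral_const, probReal_univ, one_smul, integral_mul_const, integral_const_mul, hP]
    have e' : ∀ a, W a * P a = P a * W a := fun a => mul_comm _ _
    simp only [e', hP0]; ring
  have a23 : ∫ z, T2 α β W (Function.update z 3 x) ∂(Measure.pi fun _ => μ) = W x * Q x * P0 := by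
    rw [pi_four μ (n2 3)]
    simp only [up3, T2_ap]
    have e : ∀ a b e, α a b * β e x * W a * W b * W e * W x =
      (W a * (α a b * W b)) * (W x * (β x e * W e)) := by intro a b e; rw [hβs e x]; ring
    simp only [e, integral_const, probReal_univ, one_smul, integral_const_mul, hQ]
    simp only [integral_mul_const, integral_const_mul, hP]
    have e' : ∀ a, W a * P a = P a * W a := fun a => mul_comm _ _
    simp only [e', hP0]; ring
  have a30 : ∫ z, T3 α β W (Function.update z 0 x) ∂(Measure.pi fun _ => μ)
      = 2 * (W x * (P x * Q x)) := by
    rw [pi_four μ (n3 0)]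
    simp only [up0, T3_ap]
    have e : ∀ b c, 2 * α x b * β x c * W x * W b * W c =
      (2 * W x * (α x b * W b)) * (β x c * W c) := by intros; ring
    simp only [e, integral_const, probReal_univ, one_smul, integral_const_mul, hQ,
      integral_mul_const, hP]
    ring
  have a31 : ∫ z, T3 α β W (Function.update z 1 x) ∂(Measure.pi fun _ => μ)
      = 2 * (W x * P x * Q0) := by
    rw [pi_four μ (n3 1)]
    simp only [up1, T3_ap]
    have e : ∀ a c, 2 * α a x * β a c * W a * W x * W c =
      (2 * W x * (α x a * W a)) * (β a c * W c) := by intro a c; rw [hαs a x]; ring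
    simp only [e, integral_const, probReal_univ, one_smul, integral_const_mul, hQ]
    have e' : ∀ a, 2 * W x * (α x a * W a) * Q a = 2 * W x * (α x a * Q a * W a) := by
      intros; ring
    simp only [e', integral_const_mul, f2]
    ring
  have a32 : ∫ z, T3 α β W (Function.update z 2 x) ∂(Measure.pi fun _ => μ)
      = 2 * (W x * Q x * P0) := by
    rw [pi_four μ (n3 2)]
    simp only [up2, T3_ap]
    have e : ∀ a b, 2 * α a b * β a x * W a * W b * W x =
      (2 * W x * (β x a * W a)) * (α a b * W b) := by intro a b; rw [hβs a x]; ring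
    simp only [e, integral_const, probReal_univ, one_smul, integral_const_mul, hP]
    have e' : ∀ a, 2 * W x * (β x a * W a) * P a = 2 * W x * (P a * β x a * W a) := by
      intros; ring
    simp only [e', integral_const_mul, f3]
    ring
  have a33 : ∫ z, T3 α β W (Function.update z 3 x) ∂(Measure.pi fun _ => μ)
      = 2 * (P0 * Q0) := by
    rw [pi_four μ (n3 3)]
    simp only [up3, T3_ap]
    have e : ∀ a b c, 2 * α a b * β a c * W a * W b * W c =
      (2 * W a * (α a b * W b)) * (β a c * W c) := by intros; ring
    simp only [e, integral_const, probReal_univ, one_smul, integral_const_mul, hQ,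
      integral_mul_const, hP]
    have e' : ∀ a, 2 * W a * P a * Q a = 2 * (P a * Q a * W a) := by intros; ring
    simp only [e', integral_const_mul, f4]
  rw [Fin.sum_univ_four, a10, a11, a12, a13, a20, a21, a22, a23, a30, a31, a32, a33]
  ring

theorem perm_sum (f : Fin 4 → ℝ) (hf : ∑ r, f r = 0) (c : Fin 4) :
    ∑ σ : Equiv.Perm (Fin 4), f (σ.symm c) = 0 := by
  have h1 : ∀ c', ∑ σ : Equiv.Perm (Fin 4), f (σ.symm c') = ∑ σ : Equiv.Perm (Fin 4), f (σ.symm c) := by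
    intro c'
    refine Fintype.sum_equiv (Equiv.mulLeft (Equiv.swap c c')) _ _ fun σ => ?_
    congr 1
    symm
    rw [Equiv.symm_apply_eq]
    simp
  have h2 : ∑ c', ∑ σ : Equiv.Perm (Fin 4), f (σ.symm c') = 0 := by
    rw [Finset.sum_comm]
    refine Finset.sum_eq_zero fun σ _ => ?_
    rw [Equiv.sum_comp σ.symm f, hf]
  simp_rw [h1] at h2
  simpa using h2

theorem deg_sym {h0 : (Fin 4 → Ω) → ℝ} (hn : Nice h0)
    (hdeg : ∀ x, ∑ r : Fin 4, ∫ z, h0 (Function.update z r x) ∂(Measure.pi fun _ => μ) = 0)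
    (c : Fin 4) (x : Ω) :
    ∫ z, ((1 / 24 : ℝ) * ∑ σ : Equiv.Perm (Fin 4), h0 (fun i => (Function.update z c x) (σ i)))
      ∂(Measure.pi fun _ => μ) = 0 := by
  have n1 (σ : Equiv.Perm (Fin 4)) :
      Nice (fun z : Fin 4 → Ω => h0 (fun i => (Function.update z c x) (σ i))) := by
    refine hn.comp (measurable_pi_lambda _ fun i => ?_)
    have hu : Measurable (fun z : Fin 4 → Ω => Function.update z c x) := by fun_prop
    exact (measurable_pi_apply (σ i)).comp hu
  rw [integral_const_mul, integral_finsetSum _ fun σ _ => (n1 σ).integrable _]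
  have e (σ : Equiv.Perm (Fin 4)) :
      ∫ z, h0 (fun i => (Function.update z c x) (σ i)) ∂(Measure.pi fun _ => μ) =
      ∫ z, h0 (Function.update z (σ.symm c) x) ∂(Measure.pi fun _ => μ) := by
    rw [mp_integral (marg μ σ σ.injective) (f := fun z => h0 (Function.update z (σ.symm c) x))
      (hn.comp (by fun_prop))]
    congr 1; ext z; congr 1; ext i
    by_cases hi : σ i = c
    · have : i = σ.symm c := by rw [← hi]; simp
      rw [hi, this]; simp
    · have : i ≠ σ.symm c := by rintro rfl; simp at hi
      simp [hi, this]
  simp_rw [e]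
  rw [perm_sum (fun r => ∫ z, h0 (Function.update z r x) ∂(Measure.pi fun _ => μ)) (hdeg x) c]
  simp

end core

theorem sum_fun4 {M : Type*} [AddCommMonoid M] (n : ℕ) (f : (Fin 4 → Fin n) → M) :
    ∑ t, f t = ∑ i, ∑ j, ∑ p, ∑ q, f ![i, j, p, q] := by
  have := Fintype.sum_equiv (⟨fun x => ![x.1, x.2.1, x.2.2.1, x.2.2.2], fun t => (t 0, t 1, t 2, t 3),
      fun _ => rfl, fun t => by ext i; fin_cases i <;> rfl⟩ :
      (Fin n × Fin n × Fin n × Fin n) ≃ (Fin 4 → Fin n))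
      (fun x => f ![x.1, x.2.1, x.2.2.1, x.2.2.2]) f (fun _ => rfl)
  rw [← this]
  simp only [Fintype.sum_prod_type]

theorem sym_sum (n : ℕ) (h0 : (Fin 4 → Ω) → ℝ) (X : Fin n → Ω) :
    ∑ t : Fin 4 → Fin n, ((1 / 24 : ℝ) * ∑ σ : Equiv.Perm (Fin 4), h0 (fun i => X (t (σ i)))) =
      ∑ t : Fin 4 → Fin n, h0 (fun i => X (t i)) := by
  rw [← Finset.mul_sum, Finset.sum_comm]
  have e (σ : Equiv.Perm (Fin 4)) : ∑ t : Fin 4 → Fin n, h0 (fun i => X (t (σ i))) =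
      ∑ t : Fin 4 → Fin n, h0 (fun i => X (t i)) :=
    Fintype.sum_equiv (Equiv.arrowCongr σ.symm (Equiv.refl _)) _ _ fun t => by
      congr 1
  simp_rw [e]
  rw [Finset.sum_const, Finset.card_univ, Fintype.card_perm, Fintype.card_fin]
  simp [Nat.factorial]


theorem Nice.prod {ι : Type*} (s : Finset ι) {f : ι → Ω → ℝ} (hf : ∀ i, Nice (f i)) :
    Nice (fun x => ∏ i ∈ s, f i x) := by
  choose hm C hC using hf
  refine ⟨Finset.measurable_fun_prod s fun i _ => hm i, ∏ i ∈ s, C i, fun x => ?_⟩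
  rw [Finset.abs_prod]
  exact Finset.prod_le_prod (fun _ _ => abs_nonneg _) fun i _ => hC i x

section fac
variable {d : ℕ} (k : Fin d) (μt : Fin d → Measure ℝ) [∀ r, IsProbabilityMeasure (μt r)]

theorem fac_basic {A B : (Fin d → ℝ) → ℝ} (hA : Nice A) (hB : Nice B)
    (hAk : ∀ x y, x k = y k → A x = A y) (hBk : ∀ x y, (∀ r, r ≠ k → x r = y r) → B x = B y) :
    ∫ z, A z * B z ∂(Measure.pi μt) = (∫ z, A z ∂(Measure.pi μt)) * ∫ z, B z ∂(Measure.pi μt) := by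
  classical
  rw [resample_integral μt {k} (hA.mul hB), ← integral_mul_const]
  congr 1; ext x
  rw [← integral_const_mul]
  congr 1; ext y
  congr 1
  · apply hAk; simp
  · apply hBk; intro r hr; simp [hr]

variable (ω : Fin d → ℝ → ℝ) (hω : ∀ r, Nice (ω r)) (hω1 : ∀ r, ∫ t, ω r t ∂(μt r) = 1)
  (W : (Fin d → ℝ) → ℝ) (hW : ∀ x, W x = ∏ r, ω r (x r))

include hω hW in
theorem W_nice : Nice W := by
  have : W = fun x => ∏ r, ω r (x r) := funext hW
  rw [this]
  exact Nice.prod _ fun r => (hω r).comp (measurable_pi_apply r)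

include hω1 hW in
theorem W_int : ∫ z, W z ∂(Measure.pi μt) = 1 := by
  simp_rw [hW]
  rw [integral_fintype_prod_eq_prod]
  simp [hω1]

include hω hω1 hW in
theorem fac_W {φ ψ : (Fin d → ℝ) → ℝ} (hφ : Nice φ) (hψ : Nice ψ)
    (hφk : ∀ x y, x k = y k → φ x = φ y) (hψk : ∀ x y, (∀ r, r ≠ k → x r = y r) → ψ x = ψ y) :
    ∫ z, φ z * ψ z * W z ∂(Measure.pi μt) =
      (∫ z, φ z * W z ∂(Measure.pi μt)) * ∫ z, ψ z * W z ∂(Measure.pi μt) := by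
  set R : (Fin d → ℝ) → ℝ := fun z => ∏ r ∈ Finset.univ.erase k, ω r (z r) with hR
  have hWR : ∀ z, W z = ω k (z k) * R z := by
    intro z
    rw [hW, hR, ← Finset.mul_prod_erase _ _ (Finset.mem_univ k)]
  have nR : Nice R := Nice.prod _ fun r => (hω r).comp (measurable_pi_apply r)
  have nk : Nice (fun z : Fin d → ℝ => ω k (z k)) := (hω k).comp (measurable_pi_apply k)
  have Rk : ∀ x y : Fin d → ℝ, (∀ r, r ≠ k → x r = y r) → R x = R y := by
    intro x y h
    refine Finset.prod_congr rfl fun r hr => ?_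
    rw [h r (Finset.ne_of_mem_erase hr)]
  have kk : ∀ x y : Fin d → ℝ, x k = y k → ω k (x k) = ω k (y k) := by
    intro x y h; rw [h]
  have i1 : ∫ z : Fin d → ℝ, ω k (z k) ∂(Measure.pi μt) = 1 := by
    rw [← mp_integral (measurePreserving_eval μt k) (hω k), hω1]
  have iR : ∫ z, R z ∂(Measure.pi μt) = 1 := by
    have := fac_basic k μt nk nR kk Rk
    rw [i1, one_mul] at this
    rw [← this, ← W_int μt ω hω1 W hW]
    simp only [hWR]
  have g1 : ∫ z, φ z * W z ∂(Measure.pi μt) = ∫ z, φ z * ω k (z k) ∂(Measure.pi μt) := by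
    have := fac_basic k μt (hφ.mul nk) nR (fun x y h => by rw [hφk x y h, h]) Rk
    rw [iR, mul_one] at this
    rw [← this]; simp only [hWR, mul_assoc]
  have g2 : ∫ z, ψ z * W z ∂(Measure.pi μt) = ∫ z, ψ z * R z ∂(Measure.pi μt) := by
    have := fac_basic k μt nk (hψ.mul nR) kk (fun x y h => by rw [hψk x y h, Rk x y h])
    rw [i1, one_mul] at this
    rw [← this]; simp only [hWR]
    congr 1; ext z; ring
  rw [g1, g2, ← fac_basic k μt (hφ.mul nk) (hψ.mul nR) (fun x y h => by rw [hφk x y h, h])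
    (fun x y h => by rw [hψk x y h, Rk x y h])]
  congr 1; ext z; rw [hWR]; ring

end fac

end HsicAux

open HsicAux in
/-- Proposition 3 (variance of the modified HSIC estimator). Under the product and
independence-hypothesis setting H_{0,k}, with kernels equal to 1 on the diagonal,
n²·Var(H̃SIC_n) converges to 72·ζ₂, and more precisely
Var(H̃SIC_n) = (72(n−4)(n−5)/(n(n−1)(n−2)(n−3)))·ζ₂ + O(1/n³). -/
theorem modified_hsic_estimator_variance
    (d : ℕ) (k : Fin d)
    (μt : Fin d → Measure ℝ) [∀ r, IsProbabilityMeasure (μt r)]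
    (ω : Fin d → ℝ → ℝ) (hωm : ∀ r, Measurable (ω r)) (hω0 : ∀ r t, 0 ≤ ω r t)
    (C : Fin d → ℝ) (hωb : ∀ r t, ω r t ≤ C r)
    (hω1 : ∀ r, ∫ t, ω r t ∂(μt r) = 1)
    -- the independence hypothesis H_{0,k}: the output does not depend on the k-th input
    (G : ({r : Fin d // r ≠ k} → ℝ) → ℝ) (hG : Measurable G)
    (F : (Fin d → ℝ) → ℝ) (hFG : ∀ x, F x = G fun r => x r.1)
    (lk l : ℝ → ℝ → ℝ)
    (hlkm : Measurable (Function.uncurry lk)) (hlm : Measurable (Function.uncurry l))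
    (Ck Cl : ℝ) (hlkB : ∀ a b, |lk a b| ≤ Ck) (hlB : ∀ a b, |l a b| ≤ Cl)
    (hlks : ∀ a b, lk a b = lk b a) (hls : ∀ a b, l a b = l b a)
    (hlkd : ∀ u, lk u u = 1) (hld : ∀ y, l y y = 1)
    -- the full importance weight
    (W : (Fin d → ℝ) → ℝ) (hW : ∀ x, W x = ∏ r, ω r (x r))
    -- the modified V-statistic estimator built from the first n sample points
    (V : (n : ℕ) → (Fin n → Fin d → ℝ) → ℝ)
    (hV : ∀ n X, V n X =
      (1 / (n : ℝ) ^ 2) * ∑ i, ∑ j,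
          lk (X i k) (X j k) * l (F (X i)) (F (X j)) * W (X i) * W (X j)
      + (1 / (n : ℝ) ^ 4) * ∑ i, ∑ j, ∑ p, ∑ q,
          lk (X i k) (X j k) * l (F (X p)) (F (X q))
            * W (X i) * W (X j) * W (X p) * W (X q)
      - (2 / (n : ℝ) ^ 3) * ∑ i, ∑ j, ∑ r,
          lk (X i k) (X j k) * l (F (X i)) (F (X r)) * W (X i) * W (X j) * W (X r))
    -- its expectation and variance over an i.i.d. n-sample from μ̃ = ⊗ μ̃_r
    (E Var : ℕ → ℝ)
    (hE : ∀ n, E n = ∫ X : Fin n → Fin d → ℝ, V n X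
        ∂(Measure.pi fun _ : Fin n => Measure.pi μt))
    (hVar : ∀ n, Var n = ∫ X : Fin n → Fin d → ℝ, (V n X - E n) ^ 2
        ∂(Measure.pi fun _ : Fin n => Measure.pi μt))
    -- the symmetrized weighted kernel h̃
    (htil : (Fin 4 → Fin d → ℝ) → ℝ)
    (hhtil : ∀ z, htil z = (1 / 24 : ℝ) * ∑ σ : Equiv.Perm (Fin 4),
      (lk (z (σ 0) k) (z (σ 1) k) * l (F (z (σ 0))) (F (z (σ 1)))
          * W (z (σ 0)) * W (z (σ 1))
        + lk (z (σ 0) k) (z (σ 1) k) * l (F (z (σ 2))) (F (z (σ 3)))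
          * W (z (σ 0)) * W (z (σ 1)) * W (z (σ 2)) * W (z (σ 3))
        - 2 * lk (z (σ 0) k) (z (σ 1) k) * l (F (z (σ 0))) (F (z (σ 2)))
          * W (z (σ 0)) * W (z (σ 1)) * W (z (σ 2))))
    -- ζ₂ = E_{1,2}[ E_{3,4}[h̃]² ]
    (ζ₂ : ℝ)
    (hζ₂ : ζ₂ = ∫ z₁, (∫ z₂,
        (∫ z₃, (∫ z₄, htil ![z₁, z₂, z₃, z₄] ∂(Measure.pi μt)) ∂(Measure.pi μt)) ^ 2
        ∂(Measure.pi μt)) ∂(Measure.pi μt)) :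
    Tendsto (fun n : ℕ => (n : ℝ) ^ 2 * Var n) atTop (nhds (72 * ζ₂)) ∧
      ∃ c : ℝ, ∀ n : ℕ, 4 ≤ n →
        |Var n - (72 * ((n : ℝ) - 4) * ((n : ℝ) - 5)
            / ((n : ℝ) * ((n : ℝ) - 1) * ((n : ℝ) - 2) * ((n : ℝ) - 3))) * ζ₂|
          ≤ c / (n : ℝ) ^ 3 := by
  classical
  set μ : Measure (Fin d → ℝ) := Measure.pi μt with hμ
  let α : (Fin d → ℝ) → (Fin d → ℝ) → ℝ := fun x y => lk (x k) (y k)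
  let β : (Fin d → ℝ) → (Fin d → ℝ) → ℝ := fun x y => l (F x) (F y)
  have hFm : Measurable F := by
    have : F = fun x => G fun r => x r.1 := funext hFG
    rw [this]
    exact hG.comp (by fun_prop)
  have hα : Nice (Function.uncurry α) := by
    refine ⟨?_, Ck, fun p => hlkB _ _⟩
    exact hlkm.comp (g := Function.uncurry lk)
      (f := fun p : (Fin d → ℝ) × (Fin d → ℝ) => (p.1 k, p.2 k)) (by fun_prop)
  have hβ : Nice (Function.uncurry β) := by
    refine ⟨?_, Cl, fun p => hlB _ _⟩
    exact hlm.comp (g := Function.uncurry l)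
      (f := fun p : (Fin d → ℝ) × (Fin d → ℝ) => (F p.1, F p.2)) (by fun_prop)
  have hω : ∀ r, Nice (ω r) := fun r =>
    ⟨hωm r, C r, fun t => by rw [abs_of_nonneg (hω0 r t)]; exact hωb r t⟩
  have nW : Nice W := W_nice ω hω W hW
  let P : (Fin d → ℝ) → ℝ := fun x => ∫ z, α x z * W z ∂μ
  let Q : (Fin d → ℝ) → ℝ := fun x => ∫ z, β x z * W z ∂μ
  have nP : Nice P := Nice.int (f := fun p : (Fin d → ℝ) × (Fin d → ℝ) => α p.1 p.2 * W p.2)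
    (hα.mul (nW.comp measurable_snd)) μ
  have nQ : Nice Q := Nice.int (f := fun p : (Fin d → ℝ) × (Fin d → ℝ) => β p.1 p.2 * W p.2)
    (hβ.mul (nW.comp measurable_snd)) μ
  have hFk : ∀ x y : Fin d → ℝ, (∀ r, r ≠ k → x r = y r) → F x = F y := by
    intro x y h
    rw [hFG, hFG]
    congr 1; ext r; exact h r.1 r.2
  have Pk : ∀ x y : Fin d → ℝ, x k = y k → P x = P y := by
    intro x y h; simp only [P, α, h]
  have Qk : ∀ x y : Fin d → ℝ, (∀ r, r ≠ k → x r = y r) → Q x = Q y := by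
    intro x y h; simp only [Q, β, hFk x y h]
  have nα (x : Fin d → ℝ) : Nice (α x) := hα.comp (measurable_const.prodMk measurable_id)
  have nβ (x : Fin d → ℝ) : Nice (β x) := hβ.comp (measurable_const.prodMk measurable_id)
  have αk (x : Fin d → ℝ) : ∀ y z : Fin d → ℝ, y k = z k → α x y = α x z := by
    intro y z h; simp only [α, h]
  have βk (x : Fin d → ℝ) :
      ∀ y z : Fin d → ℝ, (∀ r, r ≠ k → y r = z r) → β x y = β x z := by
    intro y z h; simp only [β, hFk y z h]
  let h0 : (Fin 4 → Fin d → ℝ) → ℝ := fun z => T1 α β W z + T2 α β W z - T3 α β W z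
  have nh0 : Nice h0 :=
    ((T1_nice hα hβ nW).add (T2_nice hα hβ nW)).sub (T3_nice hα hβ nW)
  have hdeg0 : ∀ x, ∑ r : Fin 4, ∫ z, h0 (Function.update z r x) ∂(Measure.pi fun _ => μ) = 0 := by
    intro x
    exact deg0 μ hα hβ nW (fun x y => hlks _ _) (fun x y => hls _ _) P Q _ _
      (fun _ => rfl) (fun _ => rfl) rfl rfl
      (fun x => fac_W k μt ω hω hω1 W hW (nα x) (nβ x) (αk x) (βk x))
      (fun x => fac_W k μt ω hω hω1 W hW (nα x) nQ (αk x) Qk)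
      (fun x => fac_W k μt ω hω hω1 W hW nP (nβ x) Pk (βk x))
      (fac_W k μt ω hω hω1 W hW nP nQ Pk Qk) x
  have hh : ∀ z, htil z = (1 / 24 : ℝ) * ∑ σ : Equiv.Perm (Fin 4), h0 (fun i => z (σ i)) := by
    intro z
    rw [hhtil]
    simp only [h0, T1, T2, T3, α, β]
  have nh : Nice htil := by
    have : htil = fun z => (1 / 24 : ℝ) * ∑ σ : Equiv.Perm (Fin 4), h0 (fun i => z (σ i)) :=
      funext hh
    rw [this]
    refine (Nice.const _).mul (Nice.sum _ fun σ => nh0.comp ?_)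
    exact measurable_pi_lambda _ fun i => measurable_pi_apply (σ i)
  have hsym : ∀ (z : Fin 4 → Fin d → ℝ) (σ : Equiv.Perm (Fin 4)), htil (z ∘ σ) = htil z := by
    intro z σ
    rw [hh, hh]
    congr 1
    exact Fintype.sum_equiv (Equiv.mulLeft σ) _ _ fun τ => rfl
  have hdeg : ∀ c x, ∫ z, htil (Function.update z c x) ∂(Measure.pi fun _ => μ) = 0 := by
    intro c x
    simp_rw [hh]
    exact deg_sym μ nh0 hdeg0 c x
  have hζ : ζ₂ = ∫ x, ∫ y, h2 μ htil (x, y) ^ 2 ∂μ ∂μ := by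
    rw [hζ₂]
    congr 1; ext x; congr 1; ext y; congr 1
    unfold h2
    rw [pi_four μ (f := fun z => htil ![x, y, z 2, z 3])]
    · simp
    · refine nh.comp ?_
      refine measurable_pi_lambda _ fun i => ?_
      fin_cases i <;> simp <;> fun_prop
  obtain ⟨K, hK⟩ := var_bound μ nh hsym hdeg
  refine rate Var ζ₂ K fun n hn => ?_
  have hn0 : (n : ℝ) ≠ 0 := by
    have : n ≠ 0 := by omega
    exact_mod_cast this
  have hVS : ∀ X : Fin n → Fin d → ℝ,
      V n X = (1 / (n:ℝ) ^ 4) * ∑ t : Fin 4 → Fin n, htil (fun i => X (t i)) := by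
    intro X
    simp_rw [hh]
    rw [sym_sum n h0 X, sum_fun4, hV]
    have e : ∀ i j p q : Fin n, h0 (fun m => X (![i, j, p, q] m)) =
        lk (X i k) (X j k) * l (F (X i)) (F (X j)) * W (X i) * W (X j)
        + lk (X i k) (X j k) * l (F (X p)) (F (X q)) * W (X i) * W (X j) * W (X p) * W (X q)
        - 2 * (lk (X i k) (X j k) * l (F (X i)) (F (X p)) * W (X i) * W (X j) * W (X p)) := by
      intro i j p q
      simp [h0, T1, T2, T3, α, β]
      ring
    simp_rw [e, Finset.sum_sub_distrib, Finset.sum_add_distrib, Finset.sum_const, Finset.card_univ,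
      Fintype.card_fin, nsmul_eq_mul, ← Finset.mul_sum]
    field_simp
  have hVarS : (n:ℝ) ^ 8 * Var n = ∫ X : Fin n → Fin d → ℝ,
      ((∑ t : Fin 4 → Fin n, htil (fun i => X (t i))) -
        ∫ X : Fin n → Fin d → ℝ, (∑ t : Fin 4 → Fin n, htil (fun i => X (t i)))
          ∂(Measure.pi fun _ => μ)) ^ 2 ∂(Measure.pi fun _ => μ) := by
    rw [hVar, hE]
    simp_rw [hVS]
    rw [integral_const_mul, ← integral_const_mul]
    congr 1; ext X
    field_simp
  rw [hVarS, hζ]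
  exact hK n hn
end

section
/- Assume the product and independence-hypothesis setting (H_{0,k}). Then the symmetrized weighted HSIC kernel is degenerate in mean: ∫_{(ℝ^d)⁴} h̃(z₁, z₂, z₃, z₄) d(μ̃ ⊗ μ̃ ⊗ μ̃ ⊗ μ̃)(z₁, z₂, z₃, z₄) = 0. -/
open MeasureTheory
open scoped BigOperators

lemma swk_mp {d : ℕ} (μt : Fin d → Measure ℝ) [∀ r, IsProbabilityMeasure (μt r)]
    (π : Fin d → Equiv.Perm (Fin 4)) :
    MeasurePreserving (fun (z : Fin 4 → Fin d → ℝ) i r => z (π r i) r)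
      (Measure.pi fun _ : Fin 4 => Measure.pi μt) (Measure.pi fun _ : Fin 4 => Measure.pi μt) := by
  have hm : Measurable (fun (z : Fin 4 → Fin d → ℝ) i r => z (π r i) r) := by fun_prop
  refine ⟨hm, ?_⟩
  have hc : (Measure.pi fun p : Fin 4 × Fin d => μt p.2).map (MeasurableEquiv.curry (Fin 4) (Fin d) ℝ)
      = Measure.pi fun _ : Fin 4 => Measure.pi μt := by
    have := Measure.infinitePi_map_curry (ι := Fin 4) (κ := Fin d) (X := ℝ) (fun _ j => μt j)
    simpa only [Measure.infinitePi_eq_pi] using this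
  let e : Fin 4 × Fin d ≃ Fin 4 × Fin d :=
    { toFun := fun p => (π p.2 p.1, p.2)
      invFun := fun p => ((π p.2).symm p.1, p.2)
      left_inv := fun p => by simp
      right_inv := fun p => by simp }
  have hem : Measurable (fun (x : Fin 4 × Fin d → ℝ) p => x (e p)) := by fun_prop
  have he : (Measure.pi fun p : Fin 4 × Fin d => μt p.2).map (fun x p => x (e p))
      = Measure.pi fun p : Fin 4 × Fin d => μt p.2 := by
    symm
    apply Measure.pi_eq
    intro s hs
    rw [Measure.map_apply hem (MeasurableSet.univ_pi hs)]
    have : (fun (x : Fin 4 × Fin d → ℝ) p => x (e p)) ⁻¹' (Set.univ.pi s)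
        = Set.univ.pi (fun p => s (e.symm p)) := by
      ext x
      simp only [Set.mem_preimage, Set.mem_pi, Set.mem_univ, true_imp_iff]
      constructor
      · intro h p
        have := h (e.symm p)
        rwa [e.apply_symm_apply] at this
      · intro h p
        have := h (e p)
        rwa [e.symm_apply_apply] at this
    rw [this, Measure.pi_pi, ← e.prod_comp]
    refine Finset.prod_congr rfl fun p _ => ?_
    rw [e.symm_apply_apply]
    rfl
  rw [← hc, Measure.map_map hm (MeasurableEquiv.measurable _)]
  conv_rhs => rw [← he, Measure.map_map (MeasurableEquiv.measurable _) hem]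
  rfl

lemma swk_int {α : Type*} [MeasurableSpace α] (M : Measure α) (I : ℝ) {f g h : α → ℝ}
    (hf : Integrable f M) (hg : Integrable g M) (hh : Integrable h M)
    (vf : ∫ z, f z ∂M = I) (vg : ∫ z, g z ∂M = I) (vh : ∫ z, h z ∂M = I) :
    Integrable (fun z => f z + g z - 2 * h z) M ∧ ∫ z, (f z + g z - 2 * h z) ∂M = 0 := by
  have hfg : Integrable (fun z => f z + g z) M := hf.add hg
  refine ⟨hfg.sub (hh.const_mul 2), ?_⟩
  rw [integral_sub hfg (hh.const_mul 2), integral_const_mul, integral_add hf hg, vf, vg, vh]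
  ring

lemma swk_drop {E : Type*} [MeasurableSpace E] [Inhabited E] (μ : Measure E) [IsProbabilityMeasure μ]
    (W : E → ℝ) (hWm : Measurable W) (hW1 : ∫ x, W x ∂μ = 1) (i : Fin 4)
    (X : (Fin 4 → E) → ℝ) (hX : Measurable X)
    (hdep : ∀ z z', (∀ j, j ≠ i → z j = z' j) → X z = X z') :
    ∫ z, X z * W (z i) ∂(Measure.pi fun _ : Fin 4 => μ) = ∫ z, X z ∂(Measure.pi fun _ : Fin 4 => μ) := by
  have hi : ProbabilityTheory.iIndepFun (fun (j : Fin 4) (z : Fin 4 → E) => z j)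
      (Measure.pi fun _ : Fin 4 => μ) :=
    ProbabilityTheory.iIndepFun_pi (X := fun _ x => x) (fun _ => aemeasurable_id)
  have h2 := hi.indepFun_finset ({i}ᶜ) {i} disjoint_compl_left (fun j => measurable_pi_apply j)
  have h3 := h2.comp (φ := fun y : (({i}ᶜ : Finset (Fin 4)) → E) => X (fun j => if h : j ∈ ({i}ᶜ : Finset (Fin 4)) then y ⟨j, h⟩ else default))
    (ψ := fun y : (({i} : Finset (Fin 4)) → E) => W (y ⟨i, Finset.mem_singleton_self i⟩))
    (by
      refine hX.comp (measurable_pi_lambda _ fun j => ?_)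
      by_cases h : j ∈ ({i}ᶜ : Finset (Fin 4))
      · simp only [h, dite_true]; exact measurable_pi_apply _
      · simp only [h, dite_false]; exact measurable_const)
    (by fun_prop)
  have h4 : ProbabilityTheory.IndepFun X (fun z => W (z i)) (Measure.pi fun _ : Fin 4 => μ) := by
    convert h3 using 1
    · funext z
      apply hdep
      intro j hj
      simp [hj]
    · rfl
  rw [h4.integral_fun_mul_eq_mul_integral hX.aestronglyMeasurable
    (hWm.comp (measurable_pi_apply i)).aestronglyMeasurable]
  have : ∫ z : Fin 4 → E, W (z i) ∂(Measure.pi fun _ : Fin 4 => μ) = ∫ x, W x ∂μ := by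
    have hp := measurePreserving_eval (fun _ : Fin 4 => μ) i
    have hq := integral_map (μ := Measure.pi fun _ : Fin 4 => μ) hp.measurable.aemeasurable
      (f := W) hWm.aestronglyMeasurable
    rw [hp.map_eq] at hq
    exact hq.symm
  rw [this, hW1, mul_one]

/-- Under the product/independence-hypothesis setting H_{0,k}, the symmetrized
weighted HSIC kernel h̃ is degenerate in mean: its integral against μ̃⊗μ̃⊗μ̃⊗μ̃ is 0. -/
theorem symmetrized_weighted_kernel_degenerate_in_mean
    (d : ℕ) (k : Fin d)
    (μt : Fin d → Measure ℝ) [∀ r, IsProbabilityMeasure (μt r)]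
    (ω : Fin d → ℝ → ℝ) (hωm : ∀ r, Measurable (ω r)) (hω0 : ∀ r t, 0 ≤ ω r t)
    (C : Fin d → ℝ) (hωb : ∀ r t, ω r t ≤ C r)
    (hω1 : ∀ r, ∫ t, ω r t ∂(μt r) = 1)
    (G : ({r : Fin d // r ≠ k} → ℝ) → ℝ) (hG : Measurable G)
    (F : (Fin d → ℝ) → ℝ) (hFG : ∀ x, F x = G fun r => x r.1)
    (lk l : ℝ → ℝ → ℝ)
    (hlkm : Measurable (Function.uncurry lk)) (hlm : Measurable (Function.uncurry l))
    (Ck Cl : ℝ) (hlkB : ∀ a b, |lk a b| ≤ Ck) (hlB : ∀ a b, |l a b| ≤ Cl)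
    (hlks : ∀ a b, lk a b = lk b a) (hls : ∀ a b, l a b = l b a)
    (W : (Fin d → ℝ) → ℝ) (hW : ∀ x, W x = ∏ r, ω r (x r))
    (htil : (Fin 4 → Fin d → ℝ) → ℝ)
    (hhtil : ∀ z, htil z = (1 / 24 : ℝ) * ∑ σ : Equiv.Perm (Fin 4),
      (lk (z (σ 0) k) (z (σ 1) k) * l (F (z (σ 0))) (F (z (σ 1)))
          * W (z (σ 0)) * W (z (σ 1))
        + lk (z (σ 0) k) (z (σ 1) k) * l (F (z (σ 2))) (F (z (σ 3)))
          * W (z (σ 0)) * W (z (σ 1)) * W (z (σ 2)) * W (z (σ 3))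
        - 2 * lk (z (σ 0) k) (z (σ 1) k) * l (F (z (σ 0))) (F (z (σ 2)))
          * W (z (σ 0)) * W (z (σ 1)) * W (z (σ 2)))) :
    ∫ z : Fin 4 → Fin d → ℝ, htil z
        ∂(Measure.pi fun _ : Fin 4 => Measure.pi μt) = 0 := by
  have hFm : Measurable F := by
    have : F = fun x => G fun r => x r.1 := funext hFG
    rw [this]
    exact hG.comp (by fun_prop)
  have hWe : W = fun x => ∏ r, ω r (x r) := funext hW
  have hWm : Measurable W := by
    rw [hWe]
    exact Finset.measurable_prod _ fun r _ => (hωm r).comp (measurable_pi_apply r)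
  have hWB : ∀ x, |W x| ≤ ∏ r, C r := by
    intro x
    rw [hW, abs_of_nonneg (Finset.prod_nonneg fun r _ => hω0 r _)]
    exact Finset.prod_le_prod (fun r _ => hω0 r _) (fun r _ => hωb r _)
  have hW1 : ∫ x, W x ∂(Measure.pi μt) = 1 := by
    rw [hWe, integral_fintype_prod_eq_prod]
    simp [hω1]
  have hlk' : ∀ i j : Fin 4, Measurable fun z : Fin 4 → Fin d → ℝ => lk (z i k) (z j k) := by
    intro i j
    exact hlkm.comp (f := fun z : Fin 4 → Fin d → ℝ => (z i k, z j k)) (by fun_prop)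
  have hl' : ∀ i j : Fin 4, Measurable fun z : Fin 4 → Fin d → ℝ => l (F (z i)) (F (z j)) := by
    intro i j
    exact hlm.comp (f := fun z : Fin 4 → Fin d → ℝ => (F (z i), F (z j))) (by fun_prop)
  have hW' : ∀ i : Fin 4, Measurable fun z : Fin 4 → Fin d → ℝ => W (z i) := fun i => by fun_prop
  set M := Measure.pi fun _ : Fin 4 => Measure.pi μt with hM
  let U : (Fin 4 → Fin d → ℝ) → ℝ := fun z => ∏ i, W (z i)
  have hUm : Measurable U := Finset.measurable_prod _ fun i _ => hW' i
  let I : ℝ := ∫ z, lk (z 0 k) (z 1 k) * l (F (z 0)) (F (z 1)) * U z ∂M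
  have key : ∀ σ τ : Equiv.Perm (Fin 4),
      ∫ z, lk (z (σ 0) k) (z (σ 1) k) * l (F (z (τ 0))) (F (z (τ 1))) * U z ∂M = I := by
    intro σ τ
    have hp := swk_mp μt (fun r => if r = k then σ else τ)
    have hf : Measurable fun z : Fin 4 → Fin d → ℝ =>
        lk (z 0 k) (z 1 k) * l (F (z 0)) (F (z 1)) * U z :=
      ((hlk' 0 1).mul (hl' 0 1)).mul hUm
    have h1 := integral_map (μ := M) hp.measurable.aemeasurable
      (f := fun z : Fin 4 → Fin d → ℝ => lk (z 0 k) (z 1 k) * l (F (z 0)) (F (z 1)) * U z)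
      hf.aestronglyMeasurable
    rw [hp.map_eq] at h1
    change I = _ at h1
    rw [h1]
    refine integral_congr_ae (Filter.Eventually.of_forall fun z => ?_)
    have hFz : ∀ i, F (fun r => z ((if r = k then σ else τ) i) r) = F (z (τ i)) := by
      intro i
      rw [hFG, hFG]
      congr 1
      funext r
      simp [r.2]
    have hUz : U (fun i r => z ((if r = k then σ else τ) i) r) = U z := by
      simp only [U, hW]
      rw [Finset.prod_comm]
      conv_rhs => rw [Finset.prod_comm]
      refine Finset.prod_congr rfl fun r _ => ?_
      exact Equiv.prod_comp (if r = k then σ else τ) (fun i => ω r (z i r))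
    simp only [hFz, hUz, if_true]
  have hUσ : ∀ (σ : Equiv.Perm (Fin 4)) z,
      U z = W (z (σ 0)) * W (z (σ 1)) * W (z (σ 2)) * W (z (σ 3)) := by
    intro σ z
    simp only [U]
    rw [← Equiv.prod_comp σ, Fin.prod_univ_four]
  have hint : ∀ f : (Fin 4 → Fin d → ℝ) → ℝ, Measurable f → (∃ B, ∀ z, |f z| ≤ B) →
      Integrable f M := by
    rintro f hf ⟨B, hB⟩
    exact Integrable.of_bound hf.aestronglyMeasurable B (Filter.Eventually.of_forall hB)
  have bm : ∀ f g : (Fin 4 → Fin d → ℝ) → ℝ, (∃ B, ∀ z, |f z| ≤ B) → (∃ B, ∀ z, |g z| ≤ B) →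
      (∃ B, ∀ z, |f z * g z| ≤ B) := by
    rintro f g ⟨B, hB⟩ ⟨B', hB'⟩
    refine ⟨B * B', fun z => ?_⟩
    rw [abs_mul]
    exact mul_le_mul (hB z) (hB' z) (abs_nonneg _) ((abs_nonneg _).trans (hB z))
  have bW : ∀ i : Fin 4, ∃ B, ∀ z : Fin 4 → Fin d → ℝ, |W (z i)| ≤ B := fun i => ⟨_, fun z => hWB _⟩
  have blk : ∀ i j : Fin 4, ∃ B, ∀ z : Fin 4 → Fin d → ℝ, |lk (z i k) (z j k)| ≤ B :=
    fun i j => ⟨_, fun z => hlkB _ _⟩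
  have bl : ∀ i j : Fin 4, ∃ B, ∀ z : Fin 4 → Fin d → ℝ, |l (F (z i)) (F (z j))| ≤ B :=
    fun i j => ⟨_, fun z => hlB _ _⟩
  have main : ∀ σ : Equiv.Perm (Fin 4), Integrable (fun z : Fin 4 → Fin d → ℝ =>
      (lk (z (σ 0) k) (z (σ 1) k) * l (F (z (σ 0))) (F (z (σ 1)))
          * W (z (σ 0)) * W (z (σ 1))
        + lk (z (σ 0) k) (z (σ 1) k) * l (F (z (σ 2))) (F (z (σ 3)))
          * W (z (σ 0)) * W (z (σ 1)) * W (z (σ 2)) * W (z (σ 3))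
        - 2 * lk (z (σ 0) k) (z (σ 1) k) * l (F (z (σ 0))) (F (z (σ 2)))
          * W (z (σ 0)) * W (z (σ 1)) * W (z (σ 2)))) M ∧
      ∫ z : Fin 4 → Fin d → ℝ,
      (lk (z (σ 0) k) (z (σ 1) k) * l (F (z (σ 0))) (F (z (σ 1)))
          * W (z (σ 0)) * W (z (σ 1))
        + lk (z (σ 0) k) (z (σ 1) k) * l (F (z (σ 2))) (F (z (σ 3)))
          * W (z (σ 0)) * W (z (σ 1)) * W (z (σ 2)) * W (z (σ 3))
        - 2 * lk (z (σ 0) k) (z (σ 1) k) * l (F (z (σ 0))) (F (z (σ 2)))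
          * W (z (σ 0)) * W (z (σ 1)) * W (z (σ 2))) ∂M = 0 := by
    intro σ
    have ne : ∀ a b : Fin 4, a ≠ b → σ a ≠ σ b := fun a b h h' => h (σ.injective h')
    have mA : Measurable fun z : Fin 4 → Fin d → ℝ =>
        lk (z (σ 0) k) (z (σ 1) k) * l (F (z (σ 0))) (F (z (σ 1))) * W (z (σ 0)) * W (z (σ 1)) :=
      (((hlk' _ _).mul (hl' _ _)).mul (hW' _)).mul (hW' _)
    have mB : Measurable fun z : Fin 4 → Fin d → ℝ =>
        lk (z (σ 0) k) (z (σ 1) k) * l (F (z (σ 2))) (F (z (σ 3)))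
          * W (z (σ 0)) * W (z (σ 1)) * W (z (σ 2)) * W (z (σ 3)) :=
      (((((hlk' _ _).mul (hl' _ _)).mul (hW' _)).mul (hW' _)).mul (hW' _)).mul (hW' _)
    have mC : Measurable fun z : Fin 4 → Fin d → ℝ =>
        lk (z (σ 0) k) (z (σ 1) k) * l (F (z (σ 0))) (F (z (σ 2)))
          * W (z (σ 0)) * W (z (σ 1)) * W (z (σ 2)) :=
      ((((hlk' _ _).mul (hl' _ _)).mul (hW' _)).mul (hW' _)).mul (hW' _)
    have iA := hint _ mA (bm _ _ (bm _ _ (bm _ _ (blk _ _) (bl _ _)) (bW _)) (bW _))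
    have iB := hint _ mB (bm _ _ (bm _ _ (bm _ _ (bm _ _ (bm _ _ (blk _ _) (bl _ _)) (bW _))
      (bW _)) (bW _)) (bW _))
    have iC := hint _ mC (bm _ _ (bm _ _ (bm _ _ (bm _ _ (blk _ _) (bl _ _)) (bW _)) (bW _)) (bW _))
    have mA' : Measurable fun z : Fin 4 → Fin d → ℝ =>
        lk (z (σ 0) k) (z (σ 1) k) * l (F (z (σ 0))) (F (z (σ 1))) * W (z (σ 0)) * W (z (σ 1))
          * W (z (σ 2)) := mA.mul (hW' _)
    have vA : ∫ z : Fin 4 → Fin d → ℝ,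
        lk (z (σ 0) k) (z (σ 1) k) * l (F (z (σ 0))) (F (z (σ 1))) * W (z (σ 0)) * W (z (σ 1)) ∂M
        = I := by
      rw [← key σ σ, ← swk_drop (Measure.pi μt) W hWm hW1 (σ 2) _ mA,
        ← swk_drop (Measure.pi μt) W hWm hW1 (σ 3) _ mA']
      · refine integral_congr_ae (Filter.Eventually.of_forall fun z => ?_)
        simp only [hUσ σ]
        ring
      · intro z z' h
        beta_reduce
        rw [h _ (ne 0 3 (by decide)), h _ (ne 1 3 (by decide)), h _ (ne 2 3 (by decide))]
      · intro z z' h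
        beta_reduce
        rw [h _ (ne 0 2 (by decide)), h _ (ne 1 2 (by decide))]
    have vB : ∫ z : Fin 4 → Fin d → ℝ,
        lk (z (σ 0) k) (z (σ 1) k) * l (F (z (σ 2))) (F (z (σ 3)))
          * W (z (σ 0)) * W (z (σ 1)) * W (z (σ 2)) * W (z (σ 3)) ∂M = I := by
      have e0 : (Equiv.swap (0 : Fin 4) 2 * Equiv.swap 1 3 : Equiv.Perm (Fin 4)) 0 = 2 := by decide
      have e1 : (Equiv.swap (0 : Fin 4) 2 * Equiv.swap 1 3 : Equiv.Perm (Fin 4)) 1 = 3 := by decide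
      rw [← key σ (σ * (Equiv.swap 0 2 * Equiv.swap 1 3))]
      refine integral_congr_ae (Filter.Eventually.of_forall fun z => ?_)
      simp only [hUσ σ, Equiv.Perm.mul_apply σ, e0, e1]
      ring
    have vC : ∫ z : Fin 4 → Fin d → ℝ,
        lk (z (σ 0) k) (z (σ 1) k) * l (F (z (σ 0))) (F (z (σ 2)))
          * W (z (σ 0)) * W (z (σ 1)) * W (z (σ 2)) ∂M = I := by
      have e0 : (Equiv.swap (1 : Fin 4) 2) 0 = 0 := by decide
      have e1 : (Equiv.swap (1 : Fin 4) 2) 1 = 2 := by decide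
      rw [← key σ (σ * Equiv.swap 1 2), ← swk_drop (Measure.pi μt) W hWm hW1 (σ 3) _ mC]
      · refine integral_congr_ae (Filter.Eventually.of_forall fun z => ?_)
        simp only [hUσ σ, Equiv.Perm.mul_apply σ, e0, e1]
        ring
      · intro z z' h
        beta_reduce
        rw [h _ (ne 0 3 (by decide)), h _ (ne 1 3 (by decide)), h _ (ne 2 3 (by decide))]
    simp only [mul_assoc] at iA iB iC vA vB vC ⊢
    exact swk_int M I iA iB iC vA vB vC
  simp only [hhtil]
  rw [integral_const_mul, integral_finsetSum _ fun σ _ => (main σ).1,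
    Finset.sum_eq_zero fun σ _ => (main σ).2, mul_zero]
end
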